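/- arXiv:math/0005139 — 8 statements merged into one kernel-verified Lean document; each statement's English description precedes it below -/
import Mathlib

section
/- Let a < b be real numbers and let f₀, f₁, f₂ be real-analytic functions on an open neighborhood of [a,b] that do not vanish simultaneously at any point of [a,b]. Assume the arc is transcendental: there is no nonzero homogeneous polynomial P ∈ ℝ[X,Y,Z] with P(f₀(t), f₁(t), f₂(t)) = 0 for all t ∈ [a,b]. Then for each ε > 0 there exists a constant A_ε such that for every real H ≥ 1, the number of triples (x,y,z) of coprime integers with max(|x|,|y|,|z|) ≤ H and z > 0 (or z = 0 and y > 0, or y = z = 0 and x > 0) for which there exists t ∈ [a,b] with (x,y,z) proportional to (f₀(t), f₁(t), f₂(t)) is less than A_ε · H^ε. -/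
namespace BP
open Polynomial

lemma rolle_fin (U : Set ℝ) (S : Set ℝ) (hS : S.OrdConnected) (hSU : S ⊆ U) (n : ℕ) :
    ∀ (f : ℝ → ℝ), AnalyticOnNhd ℝ f U → ∀ z : Fin (n + 1) → ℝ, StrictMono z →
      (∀ i, z i ∈ S) → (∀ i, f (z i) = 0) → ∃ ξ ∈ S, iteratedDeriv n f ξ = 0 := by
  induction n with
  | zero =>
    intro f _ z _ hz h0
    exact ⟨z 0, hz 0, by simpa using h0 0⟩
  | succ n ih =>
    intro f hf z hm hz h0
    have key : ∀ i : Fin (n + 1), ∃ c ∈ Set.Ioo (z i.castSucc) (z i.succ), deriv f c = 0 := by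
      intro i
      have hlt : z i.castSucc < z i.succ := hm Fin.castSucc_lt_succ
      refine exists_deriv_eq_zero hlt ?_ (by rw [h0, h0])
      exact hf.continuousOn.mono ((hS.out (hz _) (hz _)).trans hSU)
    choose w hw hw0 using key
    have hw1 : StrictMono w := by
      intro i j hij
      calc w i < z i.succ := (hw i).2
        _ ≤ z j.castSucc := hm.monotone (by
            rw [Fin.le_def]; simp; exact hij)
        _ < w j := (hw j).1
    have hw2 : ∀ i, w i ∈ S := by
      intro i
      exact hS.out (hz _) (hz _) ⟨(hw i).1.le, (hw i).2.le⟩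
    obtain ⟨ξ, h1, h2⟩ := ih (deriv f) hf.deriv w hw1 hw2 hw0
    exact ⟨ξ, h1, by rw [iteratedDeriv_succ']; exact h2⟩

lemma rolle_finset {U S : Set ℝ} (hS : S.OrdConnected) (hSU : S ⊆ U) {n : ℕ}
    {f : ℝ → ℝ} (hf : AnalyticOnNhd ℝ f U) (F : Finset ℝ) (hF : F.card = n + 1)
    (hFS : ∀ t ∈ F, t ∈ S) (h0 : ∀ t ∈ F, f t = 0) : ∃ ξ ∈ S, iteratedDeriv n f ξ = 0 := by
  refine rolle_fin U S hS hSU n f hf (F.orderEmbOfFin hF) (F.orderEmbOfFin hF).strictMono ?_ ?_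
  · exact fun i => hFS _ (F.orderEmbOfFin_mem hF i)
  · exact fun i => h0 _ (F.orderEmbOfFin_mem hF i)

lemma iteratedDeriv_poly (q : ℝ[X]) (n : ℕ) :
    iteratedDeriv n (fun x => q.eval x) = fun x => (derivative^[n] q).eval x := by
  induction n generalizing q with
  | zero => simp
  | succ n ih =>
    rw [iteratedDeriv_succ', Function.iterate_succ_apply, ← ih]
    congr 1
    ext x
    simp

lemma interp_error {U : Set ℝ} {a b : ℝ} (hIU : Set.Icc a b ⊆ U)
    {g : ℝ → ℝ} (hg : AnalyticOnNhd ℝ g U) {n : ℕ} (t : Fin n → ℝ) (ht : Function.Injective t)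
    (htI : ∀ i, t i ∈ Set.Icc a b) (i : Fin n) :
    ∃ ξ ∈ Set.Icc a b,
      g (t i) - (Lagrange.interpolate (Finset.Iio i) t (fun l => g (t l))).eval (t i)
        = iteratedDeriv i g ξ / (Nat.factorial i) * ∏ l ∈ Finset.Iio i, (t i - t l) := by
  set p := Lagrange.interpolate (Finset.Iio i) t (fun l => g (t l)) with hp
  set N := Lagrange.nodal (Finset.Iio i) t with hN
  have hprod : ∏ l ∈ Finset.Iio i, (t i - t l) ≠ 0 := by
    rw [Finset.prod_ne_zero_iff]
    intro l hl h
    have := ht (sub_eq_zero.1 h)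
    simp [this] at hl
  set c := (g (t i) - p.eval (t i)) / ∏ l ∈ Finset.Iio i, (t i - t l) with hc
  set q := p + C c * N with hq
  have hcard : (Finset.Iio i).card = (i : ℕ) := by simp
  have hpdeg : p.degree < (i : ℕ) := by
    have := Lagrange.degree_interpolate_lt (s := Finset.Iio i) (v := t) (fun l => g (t l)) ht.injOn
    rwa [hcard] at this
  have hNdeg : N.natDegree = (i : ℕ) := by
    rw [hN, Lagrange.natDegree_nodal, hcard]
  have hNm : N.Monic := Lagrange.nodal_monic
  have hder : derivative^[(i : ℕ)] q = C (c * (Nat.factorial i)) := by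
    rw [hq, iterate_map_add, iterate_derivative_eq_zero_of_degree_lt hpdeg, zero_add,
      iterate_derivative_C_mul]
    have : derivative^[(i : ℕ)] N = C ((Nat.factorial i : ℕ) : ℝ) := by
      have hd : (derivative^[(i : ℕ)] N).natDegree = 0 := by
        have := natDegree_iterate_derivative N i
        omega
      rw [eq_C_of_natDegree_eq_zero hd, coeff_iterate_derivative]
      have : N.coeff (0 + (i : ℕ)) = 1 := by
        rw [zero_add, ← hNdeg]; exact hNm
      rw [this]
      simp [Nat.descFactorial_self]
    rw [this, ← C_mul]
  have hqa : AnalyticOnNhd ℝ (fun x => q.eval x) U := by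
    intro x _
    exact (AnalyticOnNhd.eval_polynomial q) x (Set.mem_univ _)
  have hh : AnalyticOnNhd ℝ (fun x => g x - q.eval x) U := hg.sub hqa
  have k1 : ((Finset.Iic i).image t).card = (i : ℕ) + 1 := by
    rw [Finset.card_image_of_injective _ ht]; simp
  have k2 : ∀ x ∈ (Finset.Iic i).image t, x ∈ Set.Icc a b := by
    intro x hx
    obtain ⟨l, _, rfl⟩ := Finset.mem_image.1 hx
    exact htI l
  have k3 : ∀ x ∈ (Finset.Iic i).image t, g x - q.eval x = 0 := by
    intro x hx
    obtain ⟨l, hl, rfl⟩ := Finset.mem_image.1 hx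
    rw [Finset.mem_Iic] at hl
    simp only [hq, eval_add, eval_mul, eval_C]
    rcases hl.lt_or_eq with h | h
    · have hm : l ∈ Finset.Iio i := by simpa using h
      rw [hp, Lagrange.eval_interpolate_at_node _ ht.injOn hm, hN, Lagrange.eval_nodal_at_node hm]
      simp
    · subst h
      rw [hN, Lagrange.eval_nodal, hc, div_mul_cancel₀ _ hprod]
      ring
  obtain ⟨ξ, hξ, h0⟩ := rolle_finset Set.ordConnected_Icc hIU hh ((Finset.Iic i).image t) k1 k2 k3
  refine ⟨ξ, hξ, ?_⟩
  rw [iteratedDeriv_fun_sub (hg ξ (hIU hξ)).contDiffAt (hqa ξ (hIU hξ)).contDiffAt, iteratedDeriv_poly, hder] at h0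
  simp only [eval_C, sub_eq_zero] at h0
  rw [h0, hc]
  have : ((Nat.factorial i : ℕ) : ℝ) ≠ 0 := by positivity
  field_simp

lemma det_bound {U : Set ℝ} {a b : ℝ} (hIU : Set.Icc a b ⊆ U) {D : ℕ}
    {g : Fin D → ℝ → ℝ} (hg : ∀ j, AnalyticOnNhd ℝ (g j) U) {M : ℝ}
    (hM : ∀ j, ∀ i : Fin D, ∀ t ∈ Set.Icc a b, |iteratedDeriv i (g j) t| ≤ M)
    {δ : ℝ} (t : Fin D → ℝ) (ht : Function.Injective t)
    (htI : ∀ i, t i ∈ Set.Icc a b) (htδ : ∀ i l, |t i - t l| ≤ δ) (hM0 : 0 ≤ M) :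
    |(Matrix.of fun i j => g j (t i)).det| ≤
      (Nat.factorial D) * M ^ D * δ ^ (∑ i : Fin D, (i : ℕ)) := by
  set G : Matrix (Fin D) (Fin D) ℝ := Matrix.of fun i j => g j (t i) with hG
  let L : Matrix (Fin D) (Fin D) ℝ := Matrix.of fun i l =>
    if l < i then - (Lagrange.basis (Finset.Iio i) t l).eval (t i) else if l = i then 1 else 0
  have hL : L.det = 1 := by
    rw [Matrix.det_of_isLowerTriangular]
    · simp [L]
    · intro i j hij
      have hij : i < j := hij
      simp [L, hij.not_gt, hij.ne']
  have hLG : ∀ i j, (L * G) i j = g j (t i) -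
      (Lagrange.interpolate (Finset.Iio i) t (fun l => g j (t l))).eval (t i) := by
    intro i j
    rw [Matrix.mul_apply, Lagrange.interpolate_apply, eval_finsetSum]
    have : ∀ l, L i l * G l j = (if l = i then g j (t i) else 0) -
      (if l < i then (g j (t l)) * (Lagrange.basis (Finset.Iio i) t l).eval (t i) else 0) := by
      intro l
      rcases lt_trichotomy l i with h | h | h
      · simp [L, G, h, h.ne]; ring
      · subst h; simp [L, G]
      · simp [L, G, h.not_gt, h.ne']
    rw [Finset.sum_congr rfl (fun l _ => this l), Finset.sum_sub_distrib]
    congr 1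
    · simp
    · rw [← Finset.sum_filter]
      refine Finset.sum_congr ?_ ?_
      · ext l; simp
      · intro l _; simp
  have hent : ∀ i j, |(L * G) i j| ≤ M * δ ^ (i : ℕ) := by
    intro i j
    obtain ⟨ξ, hξ, h⟩ := interp_error hIU (hg j) t ht htI i
    rw [hLG, h, abs_mul]
    gcongr
    · rw [abs_div]
      have h1 : (1 : ℝ) ≤ |((Nat.factorial i : ℕ) : ℝ)| := by
        rw [abs_of_nonneg (by positivity)]
        exact_mod_cast Nat.one_le_iff_ne_zero.2 (Nat.factorial_ne_zero _)
      exact (div_le_self (abs_nonneg _) h1).trans (hM j i ξ hξ)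
    · rw [Finset.abs_prod]
      calc _ ≤ ∏ l ∈ Finset.Iio i, δ := Finset.prod_le_prod (fun _ _ => abs_nonneg _) (fun l _ => htδ i l)
        _ = _ := by simp
  have hdet : G.det = (L * G).det := by rw [Matrix.det_mul, hL, one_mul]
  rw [hdet, Matrix.det_apply]
  refine (Finset.abs_sum_le_sum_abs _ _).trans ?_
  calc _ ≤ ∑ σ : Equiv.Perm (Fin D), M ^ D * δ ^ (∑ i : Fin D, (i : ℕ)) := by
        refine Finset.sum_le_sum fun σ _ => ?_
        have : |Equiv.Perm.sign σ • ∏ i, (L * G) (σ i) i| = ∏ i, |(L * G) (σ i) i| := by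
          rw [← Finset.abs_prod]
          rcases Int.units_eq_one_or (Equiv.Perm.sign σ) with h | h <;> simp [h]
        rw [this]
        calc _ ≤ ∏ i, (M * δ ^ ((σ i : Fin D) : ℕ)) :=
              Finset.prod_le_prod (fun _ _ => abs_nonneg _) (fun i _ => hent _ _)
          _ = ∏ i : Fin D, (M * δ ^ (i : ℕ)) := Equiv.prod_comp σ (fun i : Fin D => M * δ ^ (i : ℕ))
          _ = _ := by
            rw [Finset.prod_mul_distrib, Finset.prod_pow_eq_pow_sum]; simp
    _ = _ := by
      simp [Fintype.card_perm]; ring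

lemma exists_deriv_ne {a b : ℝ} {f : ℝ → ℝ} (hf : AnalyticOnNhd ℝ f (Set.Icc a b))
    (hne : ∃ t ∈ Set.Icc a b, f t ≠ 0) {t₀ : ℝ} (ht₀ : t₀ ∈ Set.Icc a b) :
    ∃ k, iteratedDeriv k f t₀ ≠ 0 := by
  by_contra! h
  have h1 := (hf t₀ ht₀).hasFPowerSeriesAt
  have h2 : FormalMultilinearSeries.ofScalars ℝ (fun n => iteratedDeriv n f t₀ / (n.factorial : ℝ)) = 0 := by
    ext n
    simp [h, FormalMultilinearSeries.ofScalars]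
  rw [h2] at h1
  have h3 := hf.eqOn_zero_of_preconnected_of_eventuallyEq_zero isPreconnected_Icc ht₀ h1.eventually_eq_zero
  obtain ⟨t, ht, h4⟩ := hne
  exact h4 (h3 ht)

lemma zero_bound {U : Set ℝ} {a b : ℝ} (hIU : Set.Icc a b ⊆ U) {D : ℕ}
    {g : Fin D → ℝ → ℝ} (hg : ∀ j, AnalyticOnNhd ℝ (g j) U)
    (hne : ∀ c : Fin D → ℝ, c ≠ 0 → ∃ t ∈ Set.Icc a b, ∑ j, c j * g j t ≠ 0) :
    ∃ N : ℕ, ∀ c : Fin D → ℝ, c ≠ 0 → ∀ F : Finset ℝ, (∀ t ∈ F, t ∈ Set.Icc a b) →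
      (∀ t ∈ F, ∑ j, c j * g j t = 0) → F.card ≤ N := by
  classical
  have hA : ∀ c : Fin D → ℝ, AnalyticOnNhd ℝ (fun t => ∑ j, c j * g j t) U := by
    intro c x hx
    refine Finset.analyticAt_fun_sum _ fun j _ => ?_
    exact analyticAt_const.mul (hg j x hx)
  have hder : ∀ (c : Fin D → ℝ) (k : ℕ), ∀ x ∈ U, iteratedDeriv k (fun t => ∑ j, c j * g j t) x =
      ∑ j, c j * iteratedDeriv k (g j) x := by
    intro c k x hx
    rw [iteratedDeriv_fun_sum]
    · simp [iteratedDeriv_const_mul_field]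
    · intro j _
      exact (analyticAt_const.mul (hg j x hx)).contDiffAt
  let Q : Set ((Fin D → ℝ) × ℝ) → Prop := fun s => ∃ N : ℕ, ∀ c : Fin D → ℝ, ∀ F : Finset ℝ,
    (∀ t ∈ F, t ∈ Set.Icc a b) → (∀ t ∈ F, (c, t) ∈ s) →
      (∀ t ∈ F, ∑ j, c j * g j t = 0) → F.card ≤ N
  have hK : IsCompact ((Metric.sphere (0 : Fin D → ℝ) 1) ×ˢ Set.Icc a b) :=
    (isCompact_sphere _ _).prod isCompact_Icc
  have hQ : Q ((Metric.sphere (0 : Fin D → ℝ) 1) ×ˢ Set.Icc a b) := by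
    refine hK.induction_on (p := Q) ?_ ?_ ?_ ?_
    · refine ⟨0, fun c F _ h _ => ?_⟩
      rw [Nat.le_zero, Finset.card_eq_zero, Finset.eq_empty_iff_forall_notMem]
      exact fun t ht => h t ht
    · rintro s s' hss ⟨N, hN⟩
      exact ⟨N, fun c F h1 h2 h3 => hN c F h1 (fun t ht => hss (h2 t ht)) h3⟩
    · rintro s s' ⟨N, hN⟩ ⟨N', hN'⟩
      refine ⟨N + N', fun c F h1 h2 h3 => ?_⟩
      have e1 := hN c (F.filter (fun t => (c, t) ∈ s)) (fun t ht => h1 t (Finset.mem_filter.1 ht).1)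
        (fun t ht => (Finset.mem_filter.1 ht).2) (fun t ht => h3 t (Finset.mem_filter.1 ht).1)
      have e2 := hN' c (F.filter (fun t => ¬ (c, t) ∈ s)) (fun t ht => h1 t (Finset.mem_filter.1 ht).1)
        (fun t ht => (h2 t (Finset.mem_filter.1 ht).1).resolve_left (Finset.mem_filter.1 ht).2)
        (fun t ht => h3 t (Finset.mem_filter.1 ht).1)
      rw [← Finset.card_filter_add_card_filter_not (s := F) (fun t => (c, t) ∈ s)]
      exact add_le_add e1 e2
    · rintro ⟨c₀, t₀⟩ ⟨hc₀, ht₀⟩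
      have hc0 : c₀ ≠ 0 := by
        rintro rfl
        simp at hc₀
      obtain ⟨k, hk⟩ := exists_deriv_ne ((hA c₀).mono hIU) (hne c₀ hc0) ht₀
      rw [hder c₀ k t₀ (hIU ht₀)] at hk
      have hcont : ContinuousAt (fun q : (Fin D → ℝ) × ℝ => ∑ j, q.1 j * iteratedDeriv k (g j) q.2) (c₀, t₀) := by
        refine tendsto_finsetSum _ fun j _ => ?_
        refine ContinuousAt.mul (by fun_prop) ?_
        have : ContinuousAt (iteratedDeriv k (g j)) t₀ := by
          rw [iteratedDeriv_eq_iterate]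
          exact ((hg j).iterated_deriv k t₀ (hIU ht₀)).continuousAt
        exact ContinuousAt.comp (g := iteratedDeriv k (g j)) (f := fun q : (Fin D → ℝ) × ℝ => q.2) (x := (c₀, t₀)) this continuousAt_snd
      have hev := hcont.eventually_ne hk
      rw [nhds_prod_eq, Filter.eventually_prod_iff] at hev
      obtain ⟨pa, hpa, pb, hpb, hpab⟩ := hev
      obtain ⟨r, hr, hball⟩ := Metric.eventually_nhds_iff_ball.1 hpb
      refine ⟨{c | pa c} ×ˢ Metric.ball t₀ r, mem_nhdsWithin_of_mem_nhds (prod_mem_nhds hpa (Metric.ball_mem_nhds _ hr)), k, ?_⟩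
      intro c F h1 h2 h3
      by_contra! hlt
      obtain ⟨F', hF', hcard⟩ := Finset.exists_subset_card_eq (Nat.succ_le_of_lt hlt)
      have hS : (Set.Icc a b ∩ Metric.ball t₀ r).OrdConnected := by
        rw [Real.ball_eq_Ioo]
        exact Set.ordConnected_Icc.inter Set.ordConnected_Ioo
      obtain ⟨ξ, hξ, h0⟩ := rolle_finset hS (Set.inter_subset_left.trans hIU) (hA c) F' hcard
        (fun t ht => ⟨h1 t (hF' ht), (h2 t (hF' ht)).2⟩) (fun t ht => h3 t (hF' ht))
      rw [hder c k ξ (hIU hξ.1)] at h0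
      obtain ⟨t', ht'⟩ : F'.Nonempty := by
        rw [← Finset.card_pos]; omega
      exact hpab (h2 t' (hF' ht')).1 (hball ξ hξ.2) h0
  obtain ⟨N, hN⟩ := hQ
  refine ⟨N, fun c hc F h1 h3 => ?_⟩
  have hn : ‖c‖ ≠ 0 := norm_ne_zero_iff.2 hc
  refine hN (‖c‖⁻¹ • c) F h1 ?_ ?_
  · intro t ht
    refine ⟨?_, h1 t ht⟩
    simp [norm_smul, hn]
  · intro t ht
    have := h3 t ht
    simp only [Pi.smul_apply, smul_eq_mul, mul_assoc]
    rw [← Finset.mul_sum, this, mul_zero]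

end BP

namespace BP

lemma curve_of_minors {ι : Type} {D : ℕ} (v : ι → Fin D → ℝ)
    (h : ∀ e : Fin D → ι, Function.Injective e → (Matrix.of fun i j => v (e i) j).det = 0) :
    ∃ c : Fin D → ℝ, c ≠ 0 ∧ ∀ p, ∑ j, c j * v p j = 0 := by
  classical
  by_cases hs : Submodule.span ℝ (Set.range v) = ⊤
  · exfalso
    obtain ⟨B, hB, hspan, hli⟩ := exists_linearIndependent ℝ (Set.range v)
    rw [hs] at hspan
    let bas := Module.Basis.mk hli (by rw [Subtype.range_coe, hspan])
    have : Fintype B := FiniteDimensional.fintypeBasisIndex bas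
    have hcard : Fintype.card B = D := by
      rw [← Module.finrank_eq_card_basis bas]; simp
    let eq : Fin D ≃ B := (Fintype.equivFinOfCardEq hcard).symm
    choose w hw using fun x : B => hB x.2
    have h1 := h (fun i => w (eq i)) (by
      intro i j hij
      apply eq.injective
      apply Subtype.ext
      rw [← hw (eq i), ← hw (eq j)]
      exact congrArg v hij)
    have h2 : LinearIndependent ℝ (fun i j => (Matrix.of fun i j => v (w (eq i)) j) i j) := by
      have : LinearIndependent ℝ (fun i : Fin D => ((eq i : B) : Fin D → ℝ)) :=
        hli.comp eq eq.injective
      convert this using 2 with i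
      simp only [Matrix.of_apply]
      exact hw (eq i)
    have h3 := Matrix.linearIndependent_rows_iff_isUnit.1 h2
    rw [Matrix.isUnit_iff_isUnit_det, h1] at h3
    simp at h3
  · obtain ⟨φ, hφ, hmap⟩ := Submodule.exists_dual_map_eq_bot_of_lt_top (lt_top_iff_ne_top.2 hs) inferInstance
    have hrep : ∀ x, φ x = ∑ j, φ (Pi.single j 1) * x j := by
      intro x
      conv_lhs => rw [← Finset.univ_sum_single x]
      rw [map_sum]
      refine Finset.sum_congr rfl fun j _ => ?_
      have : (Pi.single j (x j) : Fin D → ℝ) = x j • Pi.single j 1 := by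
        rw [← Pi.single_smul]; simp
      rw [this, map_smul, smul_eq_mul, mul_comm]
    refine ⟨fun j => φ (Pi.single j 1), ?_, ?_⟩
    · intro h0
      apply hφ
      ext1
      rename_i j
      ext
      simpa using congrFun h0 j
    · intro p
      rw [← hrep]
      have : φ (v p) ∈ Submodule.map φ (Submodule.span ℝ (Set.range v)) :=
        Submodule.mem_map_of_mem (Submodule.subset_span ⟨p, rfl⟩)
      rw [hmap] at this
      simpa using this

def ex (m : ℕ) (j : Fin ((m + 1) * (m + 1))) : Fin 3 → ℕ :=
  ![((finProdFinEquiv.symm j).1 : ℕ), ((finProdFinEquiv.symm j).2 : ℕ),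
    2 * m - ((finProdFinEquiv.symm j).1 : ℕ) - ((finProdFinEquiv.symm j).2 : ℕ)]

lemma ex_inj (m : ℕ) : Function.Injective (ex m) := by
  intro i j h
  have h0 := congrFun h 0
  have h1 := congrFun h 1
  simp only [ex, Matrix.cons_val_zero, Matrix.cons_val_one] at h0 h1
  apply finProdFinEquiv.symm.injective
  exact Prod.ext (Fin.ext h0) (Fin.ext h1)

lemma ex_sum (m : ℕ) (j) : ex m j 0 + ex m j 1 + ex m j 2 = 2 * m := by
  have h0 := (finProdFinEquiv.symm j).1.2
  have h1 := (finProdFinEquiv.symm j).2.2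
  simp only [ex, Matrix.cons_val_zero, Matrix.cons_val_one, Matrix.cons_val]
  omega

def mon {R : Type} [CommRing R] (m : ℕ) (j : Fin ((m + 1) * (m + 1))) (x y z : R) : R :=
  x ^ ex m j 0 * y ^ ex m j 1 * z ^ ex m j 2

lemma mon_smul (m : ℕ) (j) (l x y z : ℝ) :
    mon m j (l * x) (l * y) (l * z) = l ^ (2 * m) * mon m j x y z := by
  rw [← ex_sum m j]; simp only [mon]; ring

lemma mon_cast (m : ℕ) (j) (x y z : ℤ) :
    mon m j (x : ℝ) (y : ℝ) (z : ℝ) = ((mon m j x y z : ℤ) : ℝ) := by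
  simp [mon]

lemma indep {a b : ℝ} {f₀ f₁ f₂ : ℝ → ℝ}
    (htrans : ∀ (d : ℕ) (P : MvPolynomial (Fin 3) ℝ), P.IsHomogeneous d → P ≠ 0 →
      ∃ t ∈ Set.Icc a b, MvPolynomial.eval ![f₀ t, f₁ t, f₂ t] P ≠ 0) (m : ℕ)
    (c : Fin ((m + 1) * (m + 1)) → ℝ) (hc : c ≠ 0) :
    ∃ t ∈ Set.Icc a b, ∑ j, c j * mon m j (f₀ t) (f₁ t) (f₂ t) ≠ 0 := by
  classical
  let s : Fin ((m + 1) * (m + 1)) → (Fin 3 →₀ ℕ) := fun j => Finsupp.equivFunOnFinite.symm (ex m j)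
  have hs : Function.Injective s := Finsupp.equivFunOnFinite.symm.injective.comp (ex_inj m)
  obtain ⟨t, ht, h⟩ := htrans (2 * m) (∑ j, MvPolynomial.monomial (s j) (c j)) (by
    refine MvPolynomial.IsHomogeneous.sum _ _ _ fun j _ => ?_
    apply MvPolynomial.isHomogeneous_monomial
    rw [Finsupp.degree_eq_sum, Fin.sum_univ_three]
    exact ex_sum m j) (by
    intro h0
    apply hc
    ext j
    have := congrArg (MvPolynomial.coeff (s j)) h0
    simpa [MvPolynomial.coeff_sum, MvPolynomial.coeff_monomial, hs.eq_iff] using this)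
  refine ⟨t, ht, ?_⟩
  convert h using 1
  rw [map_sum]
  refine Finset.sum_congr rfl fun j _ => ?_
  rw [MvPolynomial.eval_monomial, Finsupp.prod_fintype _ _ (by simp), Fin.prod_univ_three]
  simp [mon, s]

lemma primitive_eq {x y z x' y' z' : ℤ}
    (h : Int.gcd x (Int.gcd y z) = 1) (h' : Int.gcd x' (Int.gcd y' z') = 1)
    (hs : 0 < z ∨ (z = 0 ∧ 0 < y) ∨ (y = 0 ∧ z = 0 ∧ 0 < x))
    (hs' : 0 < z' ∨ (z' = 0 ∧ 0 < y') ∨ (y' = 0 ∧ z' = 0 ∧ 0 < x'))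
    (h1 : x * y' = y * x') (h2 : x * z' = z * x') (h3 : y * z' = z * y') :
    x = x' ∧ y = y' ∧ z = z' := by
  have bez : ∀ x y z : ℤ, Int.gcd x (Int.gcd y z) = 1 → ∃ u v w : ℤ, u * x + v * y + w * z = 1 := by
    intro x y z h
    have e1 := Int.gcd_eq_gcd_ab x (Int.gcd y z)
    have e2 := Int.gcd_eq_gcd_ab y z
    rw [h] at e1
    push_cast at e1
    refine ⟨x.gcdA (Int.gcd y z), y.gcdA z * x.gcdB (Int.gcd y z), y.gcdB z * x.gcdB (Int.gcd y z), ?_⟩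
    linear_combination -e1 - x.gcdB (Int.gcd y z) * e2
  obtain ⟨u, v, w, hb⟩ := bez x y z h
  obtain ⟨u', v', w', hb'⟩ := bez x' y' z' h'
  obtain ⟨k, hk⟩ : ∃ k, k = u * x' + v * y' + w * z' := ⟨_, rfl⟩
  have ex : x' = k * x := by rw [hk]; linear_combination -x' * hb - v * h1 - w * h2
  have ey : y' = k * y := by rw [hk]; linear_combination -y' * hb + u * h1 - w * h3
  have ez : z' = k * z := by rw [hk]; linear_combination -z' * hb + u * h2 + v * h3
  have hku : IsUnit k := by
    refine IsUnit.of_mul_eq_one (u' * x + v' * y + w' * z) ?_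
    rw [← hb', ex, ey, ez]; ring
  rcases Int.isUnit_iff.1 hku with h | h
  · subst h; omega
  · subst h; omega

end BP

namespace BP

lemma core (a b : ℝ) (hab : a < b) (f₀ f₁ f₂ : ℝ → ℝ) (U : Set ℝ)
    (hIU : Set.Icc a b ⊆ U)
    (hf₀ : AnalyticOnNhd ℝ f₀ U) (hf₁ : AnalyticOnNhd ℝ f₁ U) (hf₂ : AnalyticOnNhd ℝ f₂ U)
    (hnv : ∀ t ∈ Set.Icc a b, ¬(f₀ t = 0 ∧ f₁ t = 0 ∧ f₂ t = 0))
    (htrans : ∀ (d : ℕ) (P : MvPolynomial (Fin 3) ℝ), P.IsHomogeneous d → P ≠ 0 →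
      ∃ t ∈ Set.Icc a b, MvPolynomial.eval ![f₀ t, f₁ t, f₂ t] P ≠ 0) (m D : ℕ)
      (hD : D = (m + 1) * (m + 1)) :
    ∃ N : ℕ, ∃ K : ℝ, 0 ≤ K ∧ ∀ H : ℝ, 1 ≤ H → ∀ δ : ℝ, 0 ≤ δ →
      K * H ^ (2 * m * D) * δ ^ (∑ i : Fin D, (i : ℕ)) < 1 →
      ∀ F : Finset (ℤ × ℤ × ℤ), ∀ t : ℤ × ℤ × ℤ → ℝ, Set.InjOn t F →
      (∀ p ∈ F, t p ∈ Set.Icc a b) →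
      (∀ p ∈ F, (max |(p.1 : ℝ)| (max |(p.2.1 : ℝ)| |(p.2.2 : ℝ)|)) ≤ H) →
      (∀ p ∈ F, ∃ lam : ℝ, lam ≠ 0 ∧
        (p.1 : ℝ) = lam * f₀ (t p) ∧ (p.2.1 : ℝ) = lam * f₁ (t p) ∧ (p.2.2 : ℝ) = lam * f₂ (t p)) →
      (∀ p ∈ F, ∀ q ∈ F, |t p - t q| ≤ δ) → F.card ≤ N := by
  classical
  subst hD
  set D := (m + 1) * (m + 1) with hD
  let g : Fin D → ℝ → ℝ := fun j t => mon m j (f₀ t) (f₁ t) (f₂ t)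
  have hg : ∀ j, AnalyticOnNhd ℝ (g j) U := by
    intro j
    exact ((hf₀.pow _).mul (hf₁.pow _)).mul (hf₂.pow _)
  obtain ⟨N, hN⟩ := zero_bound hIU hg (indep htrans m)
  -- bound on derivatives
  have hMex : ∀ j i : Fin D, ∃ M : ℝ, ∀ t ∈ Set.Icc a b, |iteratedDeriv i (g j) t| ≤ M := by
    intro j i
    have : ContinuousOn (iteratedDeriv i (g j)) (Set.Icc a b) := by
      rw [iteratedDeriv_eq_iterate]
      exact (((hg j).iterated_deriv i).continuousOn).mono hIU
    exact isCompact_Icc.exists_bound_of_continuousOn this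
  choose M0 hM0 using hMex
  set M : ℝ := ∑ j, ∑ i, |M0 j i| with hMdef
  have hM : ∀ j, ∀ i : Fin D, ∀ t ∈ Set.Icc a b, |iteratedDeriv i (g j) t| ≤ M := by
    intro j i t ht
    calc _ ≤ |M0 j i| := (hM0 j i t ht).trans (le_abs_self _)
      _ ≤ ∑ i, |M0 j i| := Finset.single_le_sum (f := fun i => |M0 j i|) (fun _ _ => abs_nonneg _) (Finset.mem_univ i)
      _ ≤ M := Finset.single_le_sum (f := fun j => ∑ i, |M0 j i|)
        (fun _ _ => Finset.sum_nonneg fun _ _ => abs_nonneg _) (Finset.mem_univ j)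
  have hMn : 0 ≤ M := Finset.sum_nonneg fun _ _ => Finset.sum_nonneg fun _ _ => abs_nonneg _
  -- lower bound on f
  obtain ⟨c0, hc0, hlow⟩ : ∃ c0 : ℝ, 0 < c0 ∧ ∀ t ∈ Set.Icc a b, c0 ≤ |f₀ t| + |f₁ t| + |f₂ t| := by
    have hc : ContinuousOn (fun t => |f₀ t| + |f₁ t| + |f₂ t|) (Set.Icc a b) :=
      (((hf₀.continuousOn.mono hIU).abs.add (hf₁.continuousOn.mono hIU).abs).add
        (hf₂.continuousOn.mono hIU).abs)
    obtain ⟨t1, ht1, hmin⟩ := isCompact_Icc.exists_isMinOn (Set.nonempty_Icc.2 hab.le) hc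
    refine ⟨|f₀ t1| + |f₁ t1| + |f₂ t1|, ?_, fun t ht => hmin ht⟩
    by_contra! hle
    apply hnv t1 ht1
    have e0 := abs_nonneg (f₀ t1)
    have e1 := abs_nonneg (f₁ t1)
    have e2 := abs_nonneg (f₂ t1)
    refine ⟨abs_eq_zero.1 ?_, abs_eq_zero.1 ?_, abs_eq_zero.1 ?_⟩ <;> linarith
  set C : ℝ := 3 / c0 with hC
  have hCpos : 0 < C := by positivity
  refine ⟨N, C ^ (2 * m * D) * ((Nat.factorial D) * M ^ D), by positivity, ?_⟩
  intro H hH δ hδ hsmall F t htinj htI hht hlam htδ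
  choose! lam hlam0 hl0 hl1 hl2 using hlam
  have hlamb : ∀ p ∈ F, |lam p| ≤ C * H := by
    intro p hp
    have h1 := hht p hp
    rw [max_le_iff, max_le_iff] at h1
    rw [hl0 p hp, hl1 p hp, hl2 p hp, abs_mul, abs_mul, abs_mul] at h1
    have h2 : |lam p| * c0 ≤ 3 * H := by
      calc _ ≤ |lam p| * (|f₀ (t p)| + |f₁ (t p)| + |f₂ (t p)|) := by
            gcongr; exact hlow _ (htI p hp)
        _ ≤ 3 * H := by linarith [h1.1, h1.2.1, h1.2.2]
    rw [hC, div_mul_eq_mul_div, le_div_iff₀ hc0]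
    exact h2
  have hmon : ∀ p ∈ F, ∀ j, mon m j (p.1 : ℝ) (p.2.1 : ℝ) (p.2.2 : ℝ) = lam p ^ (2 * m) * g j (t p) := by
    intro p hp j
    rw [hl0 p hp, hl1 p hp, hl2 p hp, mon_smul]
  obtain ⟨c, hc, hcz⟩ := curve_of_minors (ι := F) (D := D)
    (fun p j => mon m j (p.1.1 : ℝ) (p.1.2.1 : ℝ) (p.1.2.2 : ℝ)) (by
    intro e he
    have hint : (Matrix.of fun i j => mon m j ((e i).1.1 : ℝ) ((e i).1.2.1 : ℝ) ((e i).1.2.2 : ℝ)).det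
      = (((Matrix.of fun i j => mon m j ((e i).1.1) ((e i).1.2.1) ((e i).1.2.2)).det : ℤ) : ℝ) := by
      rw [← eq_intCast (Int.castRingHom ℝ), RingHom.map_det]
      congr 1
      ext i j
      simp [mon_cast]
    have hfac : (Matrix.of fun i j => mon m j ((e i).1.1 : ℝ) ((e i).1.2.1 : ℝ) ((e i).1.2.2 : ℝ)).det
      = (∏ i, lam (e i).1 ^ (2 * m)) * (Matrix.of fun i j => g j (t (e i).1)).det := by
      rw [← Matrix.det_mul_column]
      congr 1
      ext i j
      simp only [Matrix.of_apply]
      exact hmon _ (e i).2 j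
    have hb1 : |∏ i, lam (e i).1 ^ (2 * m)| ≤ (C * H) ^ (2 * m * D) := by
      rw [Finset.abs_prod]
      calc _ ≤ ∏ i : Fin D, (C * H) ^ (2 * m) := by
            refine Finset.prod_le_prod (fun _ _ => abs_nonneg _) fun i _ => ?_
            rw [abs_pow]
            gcongr
            exact hlamb _ (e i).2
        _ = _ := by simp [← pow_mul]
    have hb2 := det_bound hIU hg hM (δ := δ) (fun i => t (e i).1)
      (fun i j hij => he (Subtype.ext (htinj (e i).2 (e j).2 hij)))
      (fun i => htI _ (e i).2) (fun i l => htδ _ (e i).2 _ (e l).2) hMn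
    have hlt : |(Matrix.of fun i j => mon m j ((e i).1.1 : ℝ) ((e i).1.2.1 : ℝ) ((e i).1.2.2 : ℝ)).det| < 1 := by
      rw [hfac, abs_mul]
      calc _ ≤ (C * H) ^ (2 * m * D) * ((Nat.factorial D) * M ^ D * δ ^ (∑ i : Fin D, (i : ℕ))) := by
            gcongr
        _ = C ^ (2 * m * D) * ((Nat.factorial D) * M ^ D) * H ^ (2 * m * D) * δ ^ (∑ i : Fin D, (i : ℕ)) := by
            rw [mul_pow]; ring
        _ < 1 := hsmall
    rw [hint] at hlt ⊢
    rw [← Int.cast_abs] at hlt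
    have : |(Matrix.of fun i j => mon m j ((e i).1.1) ((e i).1.2.1) ((e i).1.2.2)).det| < 1 := by
      exact_mod_cast hlt
    rw [Int.abs_lt_one_iff.1 this]
    simp)
  rw [← Finset.card_image_of_injOn htinj]
  refine hN c hc _ ?_ ?_
  · intro x hx
    obtain ⟨p, hp, rfl⟩ := Finset.mem_image.1 hx
    exact htI p hp
  · intro x hx
    obtain ⟨p, hp, rfl⟩ := Finset.mem_image.1 hx
    have h1 := hcz ⟨p, hp⟩
    simp only [hmon p hp] at h1
    have h2 : lam p ^ (2 * m) * ∑ j, c j * g j (t p) = 0 := by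
      rw [← h1, Finset.mul_sum]
      refine Finset.sum_congr rfl fun j _ => ?_
      ring
    exact (mul_eq_zero.1 h2).resolve_left (pow_ne_zero _ (hlam0 p hp))

end BP

/-- A transcendental analytic arc in the projective plane contains fewer than `A_ε · H^ε`
rational points of height at most `H`, for every `ε > 0`. Rational points are represented by
primitive integer triples `(x,y,z)`, normalized by a sign convention, proportional to
`(f₀(t), f₁(t), f₂(t))` for some `t ∈ [a,b]`. -/
theorem transcendental_arc_few_rational_points
    (a b : ℝ) (hab : a < b) (f₀ f₁ f₂ : ℝ → ℝ) (U : Set ℝ) (hU : IsOpen U)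
    (hIU : Set.Icc a b ⊆ U)
    (hf₀ : AnalyticOnNhd ℝ f₀ U) (hf₁ : AnalyticOnNhd ℝ f₁ U) (hf₂ : AnalyticOnNhd ℝ f₂ U)
    (hnv : ∀ t ∈ Set.Icc a b, ¬(f₀ t = 0 ∧ f₁ t = 0 ∧ f₂ t = 0))
    (htrans : ∀ (d : ℕ) (P : MvPolynomial (Fin 3) ℝ), P.IsHomogeneous d → P ≠ 0 →
      ∃ t ∈ Set.Icc a b, MvPolynomial.eval ![f₀ t, f₁ t, f₂ t] P ≠ 0) :
    ∀ ε : ℝ, 0 < ε → ∃ A : ℝ, ∀ H : ℝ, 1 ≤ H →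
      (Nat.card {p : ℤ × ℤ × ℤ //
          Int.gcd p.1 (Int.gcd p.2.1 p.2.2) = 1 ∧
          (max |(p.1 : ℝ)| (max |(p.2.1 : ℝ)| |(p.2.2 : ℝ)|)) ≤ H ∧
          (0 < p.2.2 ∨ (p.2.2 = 0 ∧ 0 < p.2.1) ∨ (p.2.1 = 0 ∧ p.2.2 = 0 ∧ 0 < p.1)) ∧
          ∃ t ∈ Set.Icc a b, ∃ lam : ℝ,
            (p.1 : ℝ) = lam * f₀ t ∧ (p.2.1 : ℝ) = lam * f₁ t ∧ (p.2.2 : ℝ) = lam * f₂ t} : ℝ)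
        < A * H ^ ε := by
  classical
  intro ε hε
  obtain ⟨m, hm⟩ := exists_nat_ge (max 1 (4 / ε))
  have hm1 : 1 ≤ m := by exact_mod_cast (le_max_left _ _).trans hm
  have hmε : 4 ≤ ε * m := by
    have := (le_max_right _ _).trans hm
    rw [div_le_iff₀ hε] at this
    linarith
  obtain ⟨D, hD⟩ : ∃ D, D = (m + 1) * (m + 1) := ⟨_, rfl⟩
  obtain ⟨N, K, hK, hcore⟩ := BP.core a b hab f₀ f₁ f₂ U hIU hf₀ hf₁ hf₂ hnv htrans m D hD
  obtain ⟨E, hE⟩ : ∃ E, E = ∑ i : Fin D, (i : ℕ) := ⟨_, rfl⟩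
  rw [← hE] at hcore
  have hE2 : E * 2 = D * (D - 1) := by
    rw [hE, Fin.sum_univ_eq_sum_range (fun i => i), Finset.sum_range_id_mul_two]
  have hD1 : D - 1 = m * (m + 2) := by
    rw [hD]; apply Nat.sub_eq_of_eq_add; ring
  have hE1 : 1 ≤ E := by
    rw [hD1] at hE2
    have : 0 < D * (m * (m + 2)) := by rw [hD]; positivity
    omega
  have hEε : ((2 * m * D : ℕ) : ℝ) ≤ ε * E := by
    have h1 : (E : ℝ) * 2 = D * (m * (m + 2)) := by
      rw [hD1] at hE2; exact_mod_cast hE2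
    have h2 : (0 : ℝ) ≤ D * m := by positivity
    push_cast
    nlinarith [mul_le_mul_of_nonneg_left hmε h2, mul_nonneg hε.le h2]
  set κ : ℝ := 1 / (K + 1) with hκ
  have hκ0 : 0 < κ := by positivity
  have hκ1 : κ ≤ 1 := by
    rw [hκ, div_le_one (by positivity)]; linarith
  refine ⟨N * ((b - a) / κ + 1) + 1, fun H hH => ?_⟩
  have hH0 : 0 < H := by linarith
  have hHε : 1 ≤ H ^ ε := Real.one_le_rpow hH hε.le
  set δ : ℝ := κ / H ^ ε with hδ
  have hδ0 : 0 < δ := by positivity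
  have hsmall : K * H ^ (2 * m * D) * δ ^ E < 1 := by
    have h1 : H ^ (2 * m * D) ≤ (H ^ ε) ^ E := by
      rw [← Real.rpow_natCast, ← Real.rpow_natCast, ← Real.rpow_mul hH0.le]
      exact Real.rpow_le_rpow_of_exponent_le hH hEε
    have h2 : κ ^ E ≤ κ := pow_le_of_le_one hκ0.le hκ1 (by omega)
    calc K * H ^ (2 * m * D) * δ ^ E ≤ K * (H ^ ε) ^ E * δ ^ E := by gcongr
      _ = K * κ ^ E := by
        rw [hδ, div_pow]; field_simp
      _ ≤ K * κ := by gcongr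
      _ < 1 := by rw [hκ, mul_one_div, div_lt_one (by positivity)]; linarith
  set S : Set (ℤ × ℤ × ℤ) := {p : ℤ × ℤ × ℤ |
          Int.gcd p.1 (Int.gcd p.2.1 p.2.2) = 1 ∧
          (max |(p.1 : ℝ)| (max |(p.2.1 : ℝ)| |(p.2.2 : ℝ)|)) ≤ H ∧
          (0 < p.2.2 ∨ (p.2.2 = 0 ∧ 0 < p.2.1) ∨ (p.2.1 = 0 ∧ p.2.2 = 0 ∧ 0 < p.1)) ∧
          ∃ t ∈ Set.Icc a b, ∃ lam : ℝ,
            (p.1 : ℝ) = lam * f₀ t ∧ (p.2.1 : ℝ) = lam * f₁ t ∧ (p.2.2 : ℝ) = lam * f₂ t} with hS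
  have hfin : S.Finite := by
    have hI : ∀ x : ℤ, |(x : ℝ)| ≤ H → x ∈ Set.Icc (-⌈H⌉) ⌈H⌉ := by
      intro x hx
      have h1 := abs_le.1 (hx.trans (Int.le_ceil H))
      exact ⟨by exact_mod_cast h1.1, by exact_mod_cast h1.2⟩
    refine Set.Finite.subset ((Set.finite_Icc (-⌈H⌉) ⌈H⌉).prod
      ((Set.finite_Icc (-⌈H⌉) ⌈H⌉).prod (Set.finite_Icc (-⌈H⌉) ⌈H⌉))) ?_
    rintro p ⟨_, h, _⟩
    rw [max_le_iff, max_le_iff] at h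
    exact ⟨hI _ h.1, hI _ h.2.1, hI _ h.2.2⟩
  have hcardeq : Nat.card S = hfin.toFinset.card := Nat.card_eq_card_finite_toFinset hfin
  change ((Nat.card S : ℕ) : ℝ) < _
  rw [hcardeq]
  have hex : ∀ p ∈ S, ∃ t ∈ Set.Icc a b, ∃ lam : ℝ, lam ≠ 0 ∧
            (p.1 : ℝ) = lam * f₀ t ∧ (p.2.1 : ℝ) = lam * f₁ t ∧ (p.2.2 : ℝ) = lam * f₂ t := by
    rintro p ⟨_, _, hsg, t, ht, lam, h0, h1, h2⟩
    refine ⟨t, ht, lam, ?_, h0, h1, h2⟩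
    rintro rfl
    simp only [zero_mul, Int.cast_eq_zero] at h0 h1 h2
    omega
  choose! t htI lam hlam0 hl0 hl1 hl2 using hex
  have htinj : Set.InjOn t S := by
    intro p hp q hq hpq
    have cr : ∀ x y x' y' : ℤ, ∀ u v : ℝ, (x : ℝ) = lam p * u → (y : ℝ) = lam p * v →
        (x' : ℝ) = lam q * u → (y' : ℝ) = lam q * v → x * y' = y * x' := by
      intro x y x' y' u v h1 h2 h3 h4
      have : (x : ℝ) * y' = y * x' := by rw [h1, h2, h3, h4]; ring
      exact_mod_cast this
    have q0 := hl0 q hq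
    have q1 := hl1 q hq
    have q2 := hl2 q hq
    rw [← hpq] at q0 q1 q2
    obtain ⟨e0, e1, e2⟩ := BP.primitive_eq hp.1 hq.1 hp.2.2.1 hq.2.2.1
      (cr _ _ _ _ _ _ (hl0 p hp) (hl1 p hp) q0 q1)
      (cr _ _ _ _ _ _ (hl0 p hp) (hl2 p hp) q0 q2)
      (cr _ _ _ _ _ _ (hl1 p hp) (hl2 p hp) q1 q2)
    exact Prod.ext e0 (Prod.ext e1 e2)
  have hcount : hfin.toFinset.card ≤ N * (Finset.range (⌊(b - a) / δ⌋₊ + 1)).card := by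
    refine Finset.card_le_mul_card_image_of_maps_to (f := fun p => ⌊(t p - a) / δ⌋₊) ?_ N ?_
    · intro p hp
      have hp := htI p (hfin.mem_toFinset.1 hp)
      rw [Finset.mem_range, Nat.lt_succ_iff]
      apply Nat.floor_le_floor
      gcongr
      exact hp.2
    · intro k _
      have hmem : ∀ p ∈ hfin.toFinset.filter (fun p => ⌊(t p - a) / δ⌋₊ = k), p ∈ S := by
        intro p hp
        exact hfin.mem_toFinset.1 (Finset.mem_filter.1 hp).1
      refine hcore H hH δ hδ0.le hsmall _ t (htinj.mono fun p hp => hmem p hp)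
        (fun p hp => htI p (hmem p hp)) (fun p hp => (hmem p hp).2.1)
        (fun p hp => ⟨lam p, hlam0 p (hmem p hp), hl0 p (hmem p hp), hl1 p (hmem p hp), hl2 p (hmem p hp)⟩) ?_
      have hb : ∀ p ∈ hfin.toFinset.filter (fun p => ⌊(t p - a) / δ⌋₊ = k),
          k * δ ≤ t p - a ∧ t p - a ≤ (k + 1) * δ := by
        intro p hp
        have h1 : 0 ≤ (t p - a) / δ := div_nonneg (sub_nonneg.2 (htI p (hmem p hp)).1) hδ0.le
        have h2 := (Nat.floor_eq_iff h1).1 (Finset.mem_filter.1 hp).2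
        exact ⟨(le_div_iff₀ hδ0).1 h2.1, ((div_lt_iff₀ hδ0).1 h2.2).le⟩
      intro p hp q hq
      have h1 := hb p hp
      have h2 := hb q hq
      rw [abs_le]
      constructor <;> linarith [h1.1, h1.2, h2.1, h2.2]
  rw [Finset.card_range] at hcount
  have hfl : ((⌊(b - a) / δ⌋₊ : ℕ) : ℝ) ≤ (b - a) / δ :=
    Nat.floor_le (div_nonneg (by linarith) hδ0.le)
  have hbd : (b - a) / δ = (b - a) / κ * H ^ ε := by
    rw [hδ]; field_simp
  calc ((hfin.toFinset.card : ℕ) : ℝ) ≤ N * ((⌊(b - a) / δ⌋₊ : ℕ) + 1) := by exact_mod_cast hcount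
    _ ≤ N * ((b - a) / κ * H ^ ε + H ^ ε) := by
      have hfl2 := hfl.trans_eq hbd
      gcongr
    _ = N * ((b - a) / κ + 1) * H ^ ε := by ring
    _ < (N * ((b - a) / κ + 1) + 1) * H ^ ε := by
      have : 0 < H ^ ε := by linarith
      linarith
end

section
/- Let n > 1 be an integer. There exist polynomials x(t) = C·tⁿ + D, y(t) = A·t^{n+1} + B·t, z(t) = A·t^{n+1} + B'·t in ℤ[t] with A ≠ 0 and B' ≠ B such that the polynomial z(t)ⁿ − y(t)ⁿ − x(t)ⁿ has degree at most n(n−3) (which for n = 2 means it is the zero polynomial), if and only if 3n(n−2) is a perfect square. -/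
open Polynomial

theorem aux_coeff_lin (a b : ℤ) (n j : ℕ) :
    ((Polynomial.C a * X + Polynomial.C b : Polynomial ℤ) ^ n).coeff j
      = a ^ j * b ^ (n - j) * (n.choose j : ℤ) := by
  have h : (Polynomial.C a * X + Polynomial.C b : Polynomial ℤ) ^ n
      = ((X + Polynomial.C b) ^ n).comp (Polynomial.C a * X) := by simp
  rw [h, Polynomial.comp_C_mul_X_coeff, Polynomial.coeff_X_add_C_pow]
  ring

theorem aux_expand (n : ℕ) (A B B' C' D : ℤ) :
    ((Polynomial.C A * X ^ (n + 1) + Polynomial.C B' * X) ^ n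
          - (Polynomial.C A * X ^ (n + 1) + Polynomial.C B * X) ^ n
          - (Polynomial.C C' * X ^ n + Polynomial.C D) ^ n : Polynomial ℤ)
    = expand ℤ n (X * ((Polynomial.C A * X + Polynomial.C B') ^ n
        - (Polynomial.C A * X + Polynomial.C B) ^ n) - (Polynomial.C C' * X + Polynomial.C D) ^ n) := by
  have e : ∀ b : ℤ, (Polynomial.C A * X ^ (n + 1) + Polynomial.C b * X : Polynomial ℤ)
      = X * (Polynomial.C A * X ^ n + Polynomial.C b) := by intro b; ring
  rw [e, e, mul_pow, mul_pow]
  simp only [map_sub, map_mul, map_pow, map_add, expand_X, expand_C]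
  ring

theorem aux_iff (M : ℕ) (A B B' C' D : ℤ) :
    (∀ k : ℕ, ((M + 3 : ℕ) : ℤ) * (((M + 3 : ℕ) : ℤ) - 3) < (k : ℤ) →
        ((Polynomial.C A * X ^ (M + 3 + 1) + Polynomial.C B' * X) ^ (M + 3)
          - (Polynomial.C A * X ^ (M + 3 + 1) + Polynomial.C B * X) ^ (M + 3)
          - (Polynomial.C C' * X ^ (M + 3) + Polynomial.C D) ^ (M + 3) : Polynomial ℤ).coeff k = 0)
    ↔ ∀ i : ℕ, M ≤ i → A ^ i * ((M + 3).choose i : ℤ) * (B' ^ (M + 3 - i) - B ^ (M + 3 - i))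
        = C' ^ (i + 1) * D ^ (M + 3 - (i + 1)) * ((M + 3).choose (i + 1) : ℤ) := by
  rw [aux_expand]
  simp only [coeff_expand (show 0 < M + 3 by omega)]
  have key : ∀ i : ℕ, (X * ((Polynomial.C A * X + Polynomial.C B') ^ (M + 3)
        - (Polynomial.C A * X + Polynomial.C B) ^ (M + 3))
        - (Polynomial.C C' * X + Polynomial.C D) ^ (M + 3) : Polynomial ℤ).coeff (i + 1)
      = A ^ i * ((M + 3).choose i : ℤ) * (B' ^ (M + 3 - i) - B ^ (M + 3 - i))
        - C' ^ (i + 1) * D ^ (M + 3 - (i + 1)) * ((M + 3).choose (i + 1) : ℤ) := by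
    intro i
    rw [coeff_sub, coeff_X_mul, coeff_sub, aux_coeff_lin, aux_coeff_lin, aux_coeff_lin]
    ring
  constructor
  · intro h i hi
    have h1 := h ((M + 3) * (i + 1)) (by push_cast; nlinarith)
    rw [if_pos (Dvd.intro _ rfl), Nat.mul_div_cancel_left _ (by omega), key] at h1
    linarith
  · intro h k hk
    split_ifs with hd
    · obtain ⟨j, rfl⟩ := hd
      rw [Nat.mul_div_cancel_left _ (by omega)]
      have hj : M < j := by
        by_contra hc
        push_cast at hk
        have : (j : ℤ) ≤ M := by exact_mod_cast not_lt.mp hc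
        nlinarith
      obtain ⟨i, rfl⟩ : ∃ i, j = i + 1 := ⟨j - 1, by omega⟩
      rw [key, h i (by omega), sub_self]
    · rfl

theorem aux_ch3 (M : ℕ) : ((M + 3).choose M : ℤ) * 6 = (M + 3) * (M + 2) * (M + 1) := by
  have h := Nat.descFactorial_eq_factorial_mul_choose (M + 3) 3
  rw [← Nat.choose_symm_of_eq_add (show M + 3 = M + 3 from rfl)] at h
  simp [Nat.descFactorial, Nat.factorial] at h
  have h' := congrArg (Nat.cast : ℕ → ℤ) h
  push_cast at h'
  linarith

theorem aux_ch2 (M : ℕ) : ((M + 3).choose (M + 1) : ℤ) * 2 = (M + 3) * (M + 2) := by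
  have h := Nat.descFactorial_eq_factorial_mul_choose (M + 3) 2
  rw [← Nat.choose_symm_of_eq_add (show M + 3 = (M + 1) + 2 from rfl)] at h
  simp [Nat.descFactorial, Nat.factorial] at h
  have h' := congrArg (Nat.cast : ℕ → ℤ) h
  push_cast at h'
  linarith

theorem aux_iff2 (M : ℕ) (A B B' C' D : ℤ) :
    (∀ i : ℕ, M ≤ i → A ^ i * ((M + 3).choose i : ℤ) * (B' ^ (M + 3 - i) - B ^ (M + 3 - i))
        = C' ^ (i + 1) * D ^ (M + 3 - (i + 1)) * ((M + 3).choose (i + 1) : ℤ)) ↔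
    (A ^ M * ((M + 3) * (M + 2) * (M + 1)) * (B' ^ 3 - B ^ 3)
        = C' ^ (M + 1) * D ^ 2 * (3 * ((M + 3) * (M + 2))) ∧
     A ^ (M + 1) * ((M + 3) * (M + 2)) * (B' ^ 2 - B ^ 2) = C' ^ (M + 2) * D * (2 * (M + 3)) ∧
     A ^ (M + 2) * (M + 3) * (B' - B) = C' ^ (M + 3)) := by
  have h3 := aux_ch3 M
  have h2 := aux_ch2 M
  have h1 : ((M + 3).choose (M + 2) : ℤ) = M + 3 := by
    rw [Nat.choose_succ_self_right (M + 2)]; push_cast; ring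
  constructor
  · intro h
    have e0 := h M le_rfl
    have e1 := h (M + 1) (by omega)
    have e2 := h (M + 2) (by omega)
    simp only [show M + 3 - M = 3 by omega, show M + 3 - (M + 1) = 2 by omega,
      show M + 3 - (M + 2) = 1 by omega, show M + 1 + 1 = M + 2 from rfl,
      show M + 2 + 1 = M + 3 from rfl, Nat.sub_self, Nat.choose_self, h1] at e0 e1 e2
    refine ⟨?_, ?_, ?_⟩
    · rw [← h3, ← h2]; linear_combination 6 * e0
    · rw [← h2]; linear_combination 2 * e1
    · push_cast at e2; linear_combination e2
  · rintro ⟨e0, e1, e2⟩ i hi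
    rw [← h3, ← h2] at e0
    rw [← h2] at e1
    obtain rfl | rfl | rfl | h : i = M ∨ i = M + 1 ∨ i = M + 2 ∨ M + 3 ≤ i := by omega
    · simp only [show i + 3 - i = 3 by omega, show i + 3 - (i + 1) = 2 by omega]
      linarith
    · simp only [show M + 3 - (M + 1) = 2 by omega, show M + 1 + 1 = M + 2 from rfl,
        show M + 3 - (M + 2) = 1 by omega, h1]
      linarith
    · simp only [show M + 3 - (M + 2) = 1 by omega, 
        show M + 2 + 1 = M + 3 from rfl, Nat.sub_self, Nat.choose_self, h1]
      push_cast
      linarith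
    · rw [Nat.choose_eq_zero_of_lt (show M + 3 < i + 1 by omega), show M + 3 - i = 0 by omega]
      simp

theorem fermat_polynomial_family_iff_square (n : ℕ) (hn : 1 < n) :
    (∃ A B B' C' D : ℤ, A ≠ 0 ∧ B' ≠ B ∧
      ∀ k : ℕ, (n : ℤ) * ((n : ℤ) - 3) < (k : ℤ) →
        ((Polynomial.C A * X ^ (n + 1) + Polynomial.C B' * X) ^ n
          - (Polynomial.C A * X ^ (n + 1) + Polynomial.C B * X) ^ n
          - (Polynomial.C C' * X ^ n + Polynomial.C D) ^ n : Polynomial ℤ).coeff k = 0)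
    ↔ ∃ m : ℤ, 3 * (n : ℤ) * ((n : ℤ) - 2) = m ^ 2 := by
  obtain rfl | ⟨M, rfl⟩ : n = 2 ∨ ∃ M, n = M + 3 := by
    by_cases h : n = 2
    · exact Or.inl h
    · exact Or.inr ⟨n - 3, by omega⟩
  · refine ⟨fun _ => ⟨0, by norm_num⟩, fun _ => ⟨1, -1, 1, 2, 0, by norm_num, by norm_num, ?_⟩⟩
    intro k _
    have : ((Polynomial.C 1 * X ^ (2 + 1) + Polynomial.C 1 * X) ^ 2
          - (Polynomial.C 1 * X ^ (2 + 1) + Polynomial.C (-1) * X) ^ 2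
          - (Polynomial.C 2 * X ^ 2 + Polynomial.C 0) ^ 2 : Polynomial ℤ) = 0 := by
      simp only [map_neg, map_one, map_zero, show (Polynomial.C 2 : Polynomial ℤ) = 2 from rfl]
      ring
    rw [this, coeff_zero]
  simp only [aux_iff, aux_iff2]
  push_cast
  have hM : (0 : ℤ) ≤ M := Int.natCast_nonneg M
  constructor
  · rintro ⟨A, B, B', C', D, hA, hB, e3, e2, e1⟩
    have hd : B' - B ≠ 0 := sub_ne_zero.mpr hB
    have hM3 : (M : ℤ) + 3 ≠ 0 := by omega
    have hM2 : (M : ℤ) + 2 ≠ 0 := by omega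
    have hC : C' ≠ 0 := by
      rintro rfl
      rw [zero_pow (by omega)] at e1
      exact mul_ne_zero (mul_ne_zero (pow_ne_zero _ hA) hM3) hd e1
    have hg : C' ^ (M + 1) ≠ 0 := pow_ne_zero _ hC
    have f2 : ((M : ℤ) + 2) * (B' + B) * C' = 2 * (M + 3) * A * D := by
      apply mul_left_cancel₀ (mul_ne_zero hg hC)
      linear_combination A * e2 - (M + 2) * (B' + B) * e1
    have f3 : ((M : ℤ) + 1) * C' ^ 2 * ((B' - B) ^ 2 + 3 * (B' + B) ^ 2)
        = 12 * (M + 3) * A ^ 2 * D ^ 2 := by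
      apply mul_left_cancel₀ (mul_ne_zero hg hM2)
      linear_combination 4 * A ^ 2 * e3
        - (M + 2) * (M + 1) * ((B' - B) ^ 2 + 3 * (B' + B) ^ 2) * e1
    have f4 : 3 * ((M : ℤ) + 3) * (M + 3 - 2) * (B' - B) ^ 2 = (3 * (B' + B)) ^ 2 := by
      apply mul_left_cancel₀ (pow_ne_zero 2 hC)
      linear_combination 3 * (M + 3) * f3
        - 9 * ((M + 2) * (B' + B) * C' + 2 * (M + 3) * A * D) * f2
    have hdvd : (B' - B) ∣ 3 * (B' + B) := by
      rw [← Int.pow_dvd_pow_iff (n := 2) (by norm_num)]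
      exact Dvd.intro_left _ f4
    obtain ⟨m, hm⟩ := hdvd
    refine ⟨m, mul_right_cancel₀ (pow_ne_zero 2 hd) ?_⟩
    rw [f4, hm]; ring
  · rintro ⟨m, hm⟩
    have hq : (6 * ((M : ℤ) + 3)) ^ (M + 2) ≠ 0 := pow_ne_zero _ (by omega)
    refine ⟨1, (m - 3) * (6 * ((M : ℤ) + 3)) ^ (M + 2), (m + 3) * (6 * ((M : ℤ) + 3)) ^ (M + 2),
      6 * (M + 3), 6 * (M + 2) * m * (6 * ((M : ℤ) + 3)) ^ (M + 2), one_ne_zero, ?_, ?_, ?_, ?_⟩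
    · intro h
      apply hq
      linarith
    · rw [pow_succ (6 * ((M : ℤ) + 3)) (M + 1)]
      generalize (6 * ((M : ℤ) + 3)) ^ (M + 1) = g
      simp only [one_pow, one_mul]
      linear_combination 108 * g * (g * (6 * (M + 3))) ^ 2 * (M + 3) * (M + 2) * hm
    · generalize (6 * ((M : ℤ) + 3)) ^ (M + 2) = g
      simp only [one_pow, one_mul]
      ring
    · rw [pow_succ (6 * ((M : ℤ) + 3)) (M + 2)]
      generalize (6 * ((M : ℤ) + 3)) ^ (M + 2) = g
      simp only [one_pow, one_mul]
      ring
end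

section
/- Let n > 1 be an integer such that 3n(n−2) is a perfect square. Then there exists a constant K > 0 such that there are infinitely many integer triples (x, y, z) with 0 < x < y < z satisfying |zⁿ − yⁿ − xⁿ| ≤ K · z^{(n²−3n)/(n+1)}. -/
open Polynomial in
lemma aux_coeff (a b : ℝ) (n j : ℕ) :
    ((C a * X + C b) ^ n : ℝ[X]).coeff j = a ^ j * b ^ (n - j) * (n.choose j : ℝ) := by
  have h : ((C a * X + C b) ^ n : ℝ[X]) = ((X + C b) ^ n).comp (C a * X) := by simp
  rw [h, comp_C_mul_X_coeff, coeff_X_add_C_pow]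
  ring

open Polynomial in
lemma aux_bound (P : ℝ[X]) (N : ℕ) (hP : P.natDegree < N + 1) (s : ℝ) (hs : 1 ≤ s) :
    |P.eval s| ≤ (∑ i ∈ Finset.range (N + 1), |P.coeff i|) * s ^ N := by
  rw [eval_eq_sum_range' hP, Finset.sum_mul]
  refine (Finset.abs_sum_le_sum_abs _ _).trans (Finset.sum_le_sum fun i hi => ?_)
  rw [abs_mul, abs_of_nonneg (by positivity : 0 ≤ s ^ i)]
  have : i ≤ N := by simpa [Nat.lt_succ_iff] using hi
  gcongr

lemma aux_choose2 (N : ℕ) : ((N + 3).choose (N + 1) : ℝ) = ((N:ℝ) + 3) * (N + 2) / 2 := by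
  rw [show (N+3).choose (N+1) = (N+3).choose 2 from Nat.choose_symm_of_eq_add (by ring),
    Nat.cast_choose_two]
  push_cast; ring

lemma aux_choose3 (N : ℕ) : ((N + 3).choose N : ℝ) = ((N:ℝ) + 3) * (N + 2) * (N + 1) / 6 := by
  rw [show (N+3).choose N = (N+3).choose 3 from Nat.choose_symm_of_eq_add (by ring)]
  have h := Nat.add_one_mul_choose_eq (N + 2) 2
  have h2 : ((N + 2).choose 2 : ℝ) = ((N:ℝ) + 2) * (N + 1) / 2 := by
    rw [Nat.cast_choose_two]; push_cast; ring
  have h' : ((N:ℝ) + 2 + 1) * ((N + 2).choose 2 : ℝ) = ((N + 3).choose 3 : ℝ) * (2 + 1) := by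
    exact_mod_cast h
  rw [h2] at h'
  linarith

open Polynomial in
lemma aux_main (N : ℕ) (m : ℝ) (hm : 3 * ((N:ℝ) + 3) * (N + 1) = m ^ 2) :
    ∃ K : ℝ, 0 < K ∧ ∀ s : ℝ, 1 ≤ s →
      |s * ((6 * ((N:ℝ) + 3) ^ 2 * s + (((N:ℝ) + 3) * m + 3 * (N + 3))) ^ (N + 3)
        - (6 * ((N:ℝ) + 3) ^ 2 * s + (((N:ℝ) + 3) * m - 3 * (N + 3))) ^ (N + 3))
        - (6 * ((N:ℝ) + 3) ^ 2 * s + ((N:ℝ) + 2) * m) ^ (N + 3)| ≤ K * s ^ N := by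
  set a : ℝ := 6 * ((N:ℝ) + 3) ^ 2 with ha
  set b₁ : ℝ := ((N:ℝ) + 3) * m + 3 * (N + 3) with hb1
  set b₂ : ℝ := ((N:ℝ) + 3) * m - 3 * (N + 3) with hb2
  set c : ℝ := ((N:ℝ) + 2) * m with hc
  let P : ℝ[X] := X * ((C a * X + C b₁) ^ (N + 3) - (C a * X + C b₂) ^ (N + 3))
    - (C a * X + C c) ^ (N + 3)
  have hdeg : P.natDegree < N + 1 := by
    rw [Nat.lt_succ_iff, natDegree_le_iff_coeff_eq_zero]
    intro j hj
    obtain ⟨k, rfl⟩ : ∃ k, j = N + 1 + k := ⟨j - (N + 1), by omega⟩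
    have e : N + 1 + k = (N + k) + 1 := by ring
    have hco : P.coeff (N + 1 + k) =
        a ^ (N + k) * b₁ ^ (N + 3 - (N + k)) * ((N + 3).choose (N + k) : ℝ)
        - a ^ (N + k) * b₂ ^ (N + 3 - (N + k)) * ((N + 3).choose (N + k) : ℝ)
        - a ^ (N + 1 + k) * c ^ (N + 3 - (N + 1 + k)) * ((N + 3).choose (N + 1 + k) : ℝ) := by
      simp only [P, coeff_sub, aux_coeff]
      rw [e, coeff_X_mul, coeff_sub, aux_coeff, aux_coeff]
    rw [hco]
    match k with
    | 0 =>
      have e1 : N + 3 - (N + 0) = 3 := by omega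
      have e2 : N + 3 - (N + 1 + 0) = 2 := by omega
      rw [e1, e2, add_zero, add_zero, aux_choose2, aux_choose3, pow_succ a N]
      have : (b₁ ^ 3 - b₂ ^ 3) * (((N:ℝ) + 1) / 3) = a * c ^ 2 := by
        have h3 : b₁ ^ 3 - b₂ ^ 3 = 18 * ((N:ℝ)+3)^3 * m^2 + 54 * ((N:ℝ)+3)^3 := by
          rw [hb1, hb2]; ring
        rw [h3, hc, mul_pow, ha, ← hm]; ring
      linear_combination (a ^ N * ((N:ℝ) + 3) * (N + 2) / 2) * this
    | 1 =>
      have e1 : N + 3 - (N + 1) = 2 := by omega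
      have e2 : N + 3 - (N + 1 + 1) = 1 := by omega
      have e3 : (N + 3).choose (N + 1 + 1) = N + 3 := Nat.choose_succ_self_right (N + 2)
      rw [e1, e2, e3, aux_choose2, pow_succ a (N + 1)]
      push_cast
      rw [hb1, hb2, hc]
      generalize a ^ (N + 1) = A
      rw [ha]; ring
    | 2 =>
      have e1 : N + 3 - (N + 2) = 1 := by omega
      have e2 : N + 3 - (N + 1 + 2) = 0 := by omega
      have e3 : (N + 3).choose (N + 2) = N + 3 := Nat.choose_succ_self_right (N + 2)
      have e4 : (N + 3).choose (N + 1 + 2) = 1 := Nat.choose_self (N + 3)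
      rw [e1, e2, e3, e4, show N + 1 + 2 = N + 2 + 1 by ring, pow_succ a (N + 2)]
      push_cast
      rw [hb1, hb2]
      generalize a ^ (N + 2) = A
      rw [ha]; ring
    | k + 3 =>
      have e1 : N + 3 - (N + (k + 3)) = 0 := by omega
      have e4 : (N + 3).choose (N + 1 + (k + 3)) = 0 := Nat.choose_eq_zero_of_lt (by omega)
      rw [e1, e4]; simp
  refine ⟨(∑ i ∈ Finset.range (N + 1), |P.coeff i|) + 1, by positivity, fun s hs => ?_⟩
  have h := aux_bound P N hdeg s hs
  have hev : P.eval s = s * ((a * s + b₁) ^ (N + 3) - (a * s + b₂) ^ (N + 3))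
    - (a * s + c) ^ (N + 3) := by simp [P]
  rw [hev] at h
  refine h.trans ?_
  gcongr
  linarith

lemma aux_bound2 (n : ℕ) (hn : 1 < n) (m : ℤ) (hm0 : 0 ≤ m)
    (hm : 3 * (n : ℤ) * ((n : ℤ) - 2) = m ^ 2) :
    ∃ K : ℝ, 0 < K ∧ ∀ t : ℝ, 1 ≤ t →
      |(t * (6 * (n:ℝ) ^ 2 * t ^ n + (n * m + 3 * n))) ^ n
        - (t * (6 * (n:ℝ) ^ 2 * t ^ n + (n * m - 3 * n))) ^ n
        - (6 * (n:ℝ) ^ 2 * t ^ n + (n - 1) * m) ^ n| ≤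
      K * (t * (6 * (n:ℝ) ^ 2 * t ^ n + (n * m + 3 * n))) ^
        (((n : ℝ) ^ 2 - 3 * (n : ℝ)) / ((n : ℝ) + 1)) := by
  have hm0' : (0:ℝ) ≤ m := by exact_mod_cast hm0
  obtain rfl | h3 : n = 2 ∨ 3 ≤ n := by omega
  · have : m = 0 := by
      have : m ^ 2 = 0 := by rw [← hm]; norm_num
      simpa using this
    subst this
    refine ⟨1, one_pos, fun t ht => ?_⟩
    have : (t * (6 * ((2:ℕ):ℝ) ^ 2 * t ^ 2 + (((2:ℕ):ℝ) * (0:ℤ) + 3 * ((2:ℕ):ℝ)))) ^ 2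
        - (t * (6 * ((2:ℕ):ℝ) ^ 2 * t ^ 2 + (((2:ℕ):ℝ) * (0:ℤ) - 3 * ((2:ℕ):ℝ)))) ^ 2
        - (6 * ((2:ℕ):ℝ) ^ 2 * t ^ 2 + (((2:ℕ):ℝ) - 1) * (0:ℤ)) ^ 2 = 0 := by
      push_cast; ring
    rw [this, abs_zero]
    have : 0 ≤ t := by linarith
    push_cast
    positivity
  · obtain ⟨N, rfl⟩ : ∃ N, n = N + 3 := ⟨n - 3, by omega⟩
    have hmr : 3 * ((N:ℝ) + 3) * (N + 1) = (m:ℝ) ^ 2 := by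
      have : ((3 * ((N + 3 : ℕ) : ℤ) * (((N + 3 : ℕ) : ℤ) - 2) : ℤ) : ℝ) = ((m ^ 2 : ℤ) : ℝ) := by
        rw [hm]
      push_cast at this
      rw [← this]; ring
    obtain ⟨K, hK, hb⟩ := aux_main N m hmr
    refine ⟨K, hK, fun t ht => ?_⟩
    have h := hb (t ^ (N + 3)) (one_le_pow₀ ht)
    have t0 : 0 < t := by linarith
    push_cast
    rw [mul_pow, mul_pow, ← mul_sub, show (N:ℝ) + 3 - 1 = N + 2 by ring]
    refine h.trans ?_
    gcongr
    have hz : t ^ (N + 4) ≤ t * (6 * ((N:ℝ) + 3) ^ 2 * t ^ (N + 3) + ((N + 3) * m + 3 * (N + 3))) := by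
      rw [show N + 4 = (N + 3) + 1 by ring, pow_succ' t (N + 3)]
      gcongr
      have h1 : (1:ℝ) ≤ 6 * ((N:ℝ) + 3) ^ 2 := by nlinarith [(Nat.cast_nonneg N : (0:ℝ) ≤ N)]
      have h2 : 0 ≤ ((N:ℝ) + 3) * m + 3 * (N + 3) := by positivity
      have h4 : 0 < t ^ (N + 3) := by positivity
      nlinarith
    have he : (0:ℝ) ≤ (((N:ℝ) + 3) ^ 2 - 3 * ((N:ℝ) + 3)) / ((N:ℝ) + 3 + 1) := by
      apply div_nonneg
      · nlinarith [(Nat.cast_nonneg N : (0:ℝ) ≤ N)]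
      · positivity
    refine le_trans (le_of_eq ?_) (Real.rpow_le_rpow (by positivity) hz he)
    rw [← pow_mul, ← Real.rpow_natCast, ← Real.rpow_natCast, ← Real.rpow_mul t0.le]
    congr 1
    have : (N:ℝ) + 3 + 1 ≠ 0 := by positivity
    push_cast
    field_simp
    ring

/-- If `n > 1` and `3n(n-2)` is a perfect square, then there are infinitely many integer triples
`(x, y, z)` with `0 < x < y < z` and `|zⁿ - yⁿ - xⁿ| ≤ K · z^((n²-3n)/(n+1))`. -/
theorem fermat_infinitely_many_close_triples (n : ℕ) (hn : 1 < n)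
    (hsq : ∃ m : ℤ, 3 * (n : ℤ) * ((n : ℤ) - 2) = m ^ 2) :
    ∃ K : ℝ, 0 < K ∧
      {p : ℤ × ℤ × ℤ | 0 < p.1 ∧ p.1 < p.2.1 ∧ p.2.1 < p.2.2 ∧
        (|p.2.2 ^ n - p.2.1 ^ n - p.1 ^ n| : ℝ) ≤
          K * (p.2.2 : ℝ) ^ (((n : ℝ) ^ 2 - 3 * (n : ℝ)) / ((n : ℝ) + 1))}.Infinite := by
  obtain ⟨m, hm0, hm⟩ : ∃ m : ℤ, 0 ≤ m ∧ 3 * (n : ℤ) * ((n : ℤ) - 2) = m ^ 2 := by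
    obtain ⟨m, hm⟩ := hsq
    exact ⟨|m|, abs_nonneg m, by rw [sq_abs, hm]⟩
  obtain ⟨K, hK, hb⟩ := aux_bound2 n hn m hm0 hm
  refine ⟨K, hK, ?_⟩
  have hn' : (2:ℤ) ≤ n := by exact_mod_cast hn
  let f : ℕ → ℤ × ℤ × ℤ := fun k =>
    (6 * (n:ℤ) ^ 2 * ((k:ℤ) + 2) ^ n + (n - 1) * m,
     ((k:ℤ) + 2) * (6 * (n:ℤ) ^ 2 * ((k:ℤ) + 2) ^ n + (n * m - 3 * n)),
     ((k:ℤ) + 2) * (6 * (n:ℤ) ^ 2 * ((k:ℤ) + 2) ^ n + (n * m + 3 * n)))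
  refine Set.infinite_of_injective_forall_mem (f := f) ?_ ?_
  · intro k l h
    have h1 := congrArg Prod.fst h
    simp only [f] at h1
    have h2 : (6 * (n:ℤ) ^ 2) * ((k:ℤ) + 2) ^ n = (6 * (n:ℤ) ^ 2) * ((l:ℤ) + 2) ^ n := by linarith
    have h3 := mul_left_cancel₀ (by positivity) h2
    have h4 := (pow_left_inj₀ (by positivity) (by positivity) (by omega)).1 h3
    have : (k:ℤ) = l := by linarith
    exact_mod_cast this
  · intro k
    obtain ⟨t, ht⟩ : ∃ t : ℤ, t = (k:ℤ) + 2 := ⟨_, rfl⟩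
    have ht2 : 2 ≤ t := by omega
    have hs : t ≤ t ^ n := le_self_pow₀ (by omega) (by omega)
    simp only [f, ← ht, Set.mem_ofPred_eq]
    have hA : 0 ≤ (n - 1 : ℤ) * m := mul_nonneg (by omega) hm0
    refine ⟨?_, ?_, ?_, ?_⟩
    · have : 0 < 6 * (n:ℤ) ^ 2 * t ^ n := by positivity
      linarith
    · set s := t ^ n
      have h1 : 0 ≤ (t - 2) * (6 * (n:ℤ) ^ 2 * s) := mul_nonneg (by omega) (by positivity)
      have h2 : 6 * (n:ℤ) ^ 2 * t ≤ 6 * (n:ℤ) ^ 2 * s := by gcongr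
      have h3 : 0 ≤ (n:ℤ) * m := by positivity
      have h4 : 0 ≤ (t - 1) * ((n:ℤ) * m) := mul_nonneg (by omega) h3
      have h5 : 0 < (n:ℤ) * t * (2 * n - 1) := mul_pos (by positivity) (by omega)
      nlinarith
    · have : (0:ℤ) < 3 * n := by omega
      gcongr
      linarith
    · have h := hb (t:ℝ) (by exact_mod_cast (by omega : 1 ≤ t))
      push_cast
      exact h
end

section
/- Let n ≥ 3 be an integer and let m, c, A be rational numbers with n² − 2n = 3m². Define z(t) = A·(t^{n+1} + c(m+1)t) and y(t) = A·(t^{n+1} + c(m−1)t) in ℚ[t]. Then the polynomial z(t)ⁿ − y(t)ⁿ − 2cn·Aⁿ·(tⁿ + ((n−1)/n)·c·m)ⁿ has degree at most n² − 3n. -/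
open Polynomial

lemma aux_deg (n : ℕ) (hn : 3 ≤ n) (m c A : ℚ)
    (hm : (n : ℚ) ^ 2 - 2 * n = 3 * m ^ 2) :
    (C (A ^ n) * (X * ((X + C (c * (m + 1))) ^ n - (X + C (c * (m - 1))) ^ n))
      - C (2 * c * n * A ^ n) * (X + C (((n : ℚ) - 1) / (n : ℚ) * c * m)) ^ n :
        Polynomial ℚ).natDegree ≤ n - 3 := by
  rw [natDegree_le_iff_coeff_eq_zero]
  intro N hN
  obtain ⟨k, rfl⟩ := Nat.exists_eq_add_of_le' hn
  obtain ⟨j, rfl⟩ : ∃ j, N = k + j + 1 := ⟨N - k - 1, by omega⟩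
  simp only [coeff_sub, coeff_C_mul, coeff_X_mul, coeff_X_add_C_pow]
  have h0 : ((k + 3 : ℕ) : ℚ) ≠ 0 := by positivity
  have c3 : (((k + 3).choose k : ℕ) : ℚ) = (k + 3) * (k + 2) * (k + 1) / 6 := by
    rw [Nat.choose_symm_add, Nat.cast_choose_eq_ascPochhammer_div]
    simp [ascPochhammer_succ_right, Nat.factorial]
    ring
  have c2 : (((k + 3).choose (k + 1) : ℕ) : ℚ) = (k + 3) * (k + 2) / 2 := by
    rw [show k + 3 = (k + 1) + 2 by ring, Nat.choose_symm_add, Nat.cast_choose_two]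
    push_cast; ring
  have c1 : (((k + 3).choose (k + 2) : ℕ) : ℚ) = k + 3 := by
    rw [show k + 3 = (k + 2) + 1 by ring, Nat.choose_symm_add, Nat.choose_one_right]
    push_cast; ring
  match j with
  | 0 =>
    simp only [add_zero, show k + 3 - k = 3 by omega, show k + 3 - (k + 1) = 2 by omega, c3, c2]
    push_cast at hm h0 ⊢
    field_simp
    have hm' : m ^ 2 = ((k + 3) ^ 2 - 2 * (k + 3 : ℚ)) / 3 := by linarith
    ring_nf at hm' ⊢
    simp only [hm']
    ring
  | 1 =>
    simp only [show k + 3 - (k + 1) = 2 by omega, show k + 1 + 1 = k + 2 by omega,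
      show k + 3 - (k + 2) = 1 by omega, c1, c2]
    push_cast at h0 ⊢
    field_simp
    ring
  | 2 =>
    simp only [show k + 2 + 1 = k + 3 by omega, Nat.choose_self,
      show k + 3 - (k + 2) = 1 by omega, Nat.sub_self, c1]
    push_cast at h0 ⊢
    ring
  | 3 => simp
  | j + 4 =>
    rw [Nat.choose_eq_zero_of_lt (by omega : k + 3 < k + (j + 4)),
      Nat.choose_eq_zero_of_lt (by omega : k + 3 < k + (j + 4) + 1)]
    simp


/-- For `n ≥ 3` and rationals `m, c, A` with `n² - 2n = 3m²`, letting
`z(t) = A(t^{n+1} + c(m+1)t)` and `y(t) = A(t^{n+1} + c(m-1)t)`, the polynomial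
`z(t)ⁿ - y(t)ⁿ - 2cn Aⁿ (tⁿ + ((n-1)/n) c m)ⁿ` has degree at most `n² - 3n`. -/
theorem fermat_family_main_term (n : ℕ) (hn : 3 ≤ n) (m c A : ℚ)
    (hm : (n : ℚ) ^ 2 - 2 * n = 3 * m ^ 2) :
    ((Polynomial.C A * (X ^ (n + 1) + Polynomial.C (c * (m + 1)) * X)) ^ n
      - (Polynomial.C A * (X ^ (n + 1) + Polynomial.C (c * (m - 1)) * X)) ^ n
      - Polynomial.C (2 * c * n * A ^ n) *
          (X ^ n + Polynomial.C (((n : ℚ) - 1) / (n : ℚ) * c * m)) ^ n :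
        Polynomial ℚ).degree ≤ ((n ^ 2 - 3 * n : ℕ) : WithBot ℕ) := by
  have key := aux_deg n hn m c A hm
  set P := (C (A ^ n) * (X * ((X + C (c * (m + 1))) ^ n - (X + C (c * (m - 1))) ^ n))
      - C (2 * c * n * A ^ n) * (X + C (((n : ℚ) - 1) / (n : ℚ) * c * m)) ^ n :
        Polynomial ℚ) with hP
  have e : ((Polynomial.C A * (X ^ (n + 1) + Polynomial.C (c * (m + 1)) * X)) ^ n
      - (Polynomial.C A * (X ^ (n + 1) + Polynomial.C (c * (m - 1)) * X)) ^ n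
      - Polynomial.C (2 * c * n * A ^ n) *
          (X ^ n + Polynomial.C (((n : ℚ) - 1) / (n : ℚ) * c * m)) ^ n :
        Polynomial ℚ) = expand ℚ n P := by
    rw [hP]
    simp only [map_sub, map_mul (expand ℚ n), map_pow (expand ℚ n), map_add (expand ℚ n),
      expand_X, expand_C]
    have h : ∀ r : ℚ, (C A * (X ^ (n + 1) + C r * X) : ℚ[X]) ^ n
        = C (A ^ n) * (X ^ n * (X ^ n + C r) ^ n) := by
      intro r
      rw [C_pow, ← mul_pow, ← mul_pow]
      ring
    rw [h, h]
    ring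
  rw [e]
  refine degree_le_natDegree.trans ?_
  rw [natDegree_expand]
  refine Nat.cast_le.mpr ((Nat.mul_le_mul_right n key).trans ?_)
  rw [Nat.sub_mul, pow_two]
end

section
/- Let n ≥ 3 be an integer. Then the polynomial (2n·uⁿ + 1)ⁿ − (2n·uⁿ − 1)ⁿ − (2n·u^{n−1})ⁿ in ℤ[u] has degree at most n(n−3). -/
open Polynomial

lemma aux_natDegree (m : ℕ) :
    ((X + 1) ^ (m + 3) - (X - 1) ^ (m + 3)
      - C (2 * ((m + 3 : ℕ) : ℤ)) * X ^ (m + 2) : Polynomial ℤ).natDegree ≤ m := by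
  rw [natDegree_le_iff_coeff_eq_zero]
  intro k hk
  have e : (X - 1 : Polynomial ℤ) = X + C (-1) := by simp [sub_eq_add_neg]
  rw [e, coeff_sub, coeff_sub, coeff_X_add_one_pow, coeff_X_add_C_pow, coeff_C_mul, coeff_X_pow]
  rcases lt_or_ge (m + 3) k with h | h
  · have : k ≠ m + 2 := by omega
    simp [Nat.choose_eq_zero_of_lt h, this]
  · obtain rfl | rfl | rfl : k = m + 1 ∨ k = m + 2 ∨ k = m + 3 := by omega
    · have : m + 3 - (m + 1) = 2 := by omega
      simp [this]
    · have : m + 3 - (m + 2) = 1 := by omega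
      rw [this, Nat.choose_succ_self_right]
      simp
      ring
    · simp

/-- For `n ≥ 3`, the polynomial `(2n uⁿ + 1)ⁿ - (2n uⁿ - 1)ⁿ - (2n u^{n-1})ⁿ` in `ℤ[u]`
has degree at most `n(n-3)`. -/
theorem fermat_diff_specialization_degree (n : ℕ) (hn : 3 ≤ n) :
    ((Polynomial.C (2 * (n : ℤ)) * X ^ n + 1) ^ n
      - (Polynomial.C (2 * (n : ℤ)) * X ^ n - 1) ^ n
      - (Polynomial.C (2 * (n : ℤ)) * X ^ (n - 1)) ^ n : Polynomial ℤ).degree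
      ≤ ((n * (n - 3) : ℕ) : WithBot ℕ) := by
  obtain ⟨m, rfl⟩ : ∃ m, n = m + 3 := ⟨n - 3, by omega⟩
  have h1 : m + 3 - 1 = m + 2 := by omega
  have h2 : m + 3 - 3 = m := by omega
  rw [h1, h2]
  apply degree_le_of_natDegree_le
  have key := aux_natDegree m
  generalize ((m + 3 : ℕ) : ℤ) = a at *
  have hc : ((C (2 * a) * X ^ (m + 3) + 1) ^ (m + 3) - (C (2 * a) * X ^ (m + 3) - 1) ^ (m + 3)
      - (C (2 * a) * X ^ (m + 2)) ^ (m + 3) : Polynomial ℤ)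
      = ((X + 1) ^ (m + 3) - (X - 1) ^ (m + 3) - C (2 * a) * X ^ (m + 2) : Polynomial ℤ).comp
        (C (2 * a) * X ^ (m + 3)) := by
    simp only [sub_comp, pow_comp, add_comp, mul_comp, X_comp, one_comp, C_comp]
    congr 1
    rw [mul_pow, mul_pow, ← pow_mul, ← pow_mul, ← mul_assoc, ← pow_succ', mul_comm (m + 2)]
  rw [hc, natDegree_comp, mul_comm (m + 3)]
  exact Nat.mul_le_mul key (natDegree_C_mul_X_pow_le _ _)
end

section
/- Let x, y, z be positive real numbers and set u = z^{1/3} − x^{1/3} − y^{1/3} and N = (z − y − x)³ − 27xyz. Then u > 0 if and only if N > 0, u = 0 if and only if N = 0, and u < 0 if and only if N < 0. -/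
/-- For positive reals `x, y, z`, the sign of `u = z^{1/3} - x^{1/3} - y^{1/3}` agrees with the
sign of `N = (z - y - x)³ - 27xyz`. -/
theorem cube_root_sign_iff_norm_sign (x y z : ℝ) (hx : 0 < x) (hy : 0 < y) (hz : 0 < z) :
    (0 < z ^ ((1 : ℝ) / 3) - x ^ ((1 : ℝ) / 3) - y ^ ((1 : ℝ) / 3) ↔
        0 < (z - y - x) ^ 3 - 27 * x * y * z) ∧
      (z ^ ((1 : ℝ) / 3) - x ^ ((1 : ℝ) / 3) - y ^ ((1 : ℝ) / 3) = 0 ↔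
        (z - y - x) ^ 3 - 27 * x * y * z = 0) ∧
      (z ^ ((1 : ℝ) / 3) - x ^ ((1 : ℝ) / 3) - y ^ ((1 : ℝ) / 3) < 0 ↔
        (z - y - x) ^ 3 - 27 * x * y * z < 0) := by
  have key : ∀ t : ℝ, 0 < t → ∃ a : ℝ, 0 < a ∧ t ^ ((1 : ℝ) / 3) = a ∧ t = a ^ 3 := by
    intro t ht
    refine ⟨t ^ ((1 : ℝ) / 3), Real.rpow_pos_of_pos ht _, rfl, ?_⟩
    rw [← Real.rpow_natCast, ← Real.rpow_mul ht.le]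
    norm_num
  obtain ⟨a, ha, hxa, hxe⟩ := key x hx
  obtain ⟨b, hb, hyb, hye⟩ := key y hy
  obtain ⟨c, hc, hzc, hze⟩ := key z hz
  rw [hxa, hyb, hzc]
  obtain ⟨K, hK, hN⟩ : ∃ K : ℝ, 0 < K ∧
      (z - y - x) ^ 3 - 27 * x * y * z = (c - a - b) * K := by
    refine ⟨(a ^ 2 + b ^ 2 + c ^ 2 + c * a + c * b - a * b) *
      ((z - y - x) ^ 2 + (z - y - x) * (3 * a * b * c) + (3 * a * b * c) ^ 2), ?_, ?_⟩
    · apply mul_pos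
      · have h1 := mul_pos hc ha
        have h2 := mul_pos hc hb
        nlinarith [sq_nonneg (a - b), sq_nonneg (a + b), sq_nonneg c]
      · have h3 : 0 < 3 * a * b * c := by positivity
        nlinarith [sq_nonneg ((z - y - x) + (3 * a * b * c) / 2), pow_pos h3 2]
    · rw [hxe, hye, hze]
      ring
  rw [hN]
  refine ⟨(mul_pos_iff_of_pos_right hK).symm, ?_, ⟨fun h => mul_neg_of_neg_of_pos h hK, fun h => by_contra fun h2 => absurd (mul_nonneg (not_lt.mp h2) hK.le) (not_le.mpr h)⟩⟩
  simp [hK.ne']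
end

section
/- For each positive rational number c there exists a constant C > 0 such that for every real number r, every real d > 1, and every real X ≥ 2, the number of pairs of integers (x, y) with 1 ≤ x ≤ X and |√(c·x³) − (y + r)| < d·X^{−1/2} is at most C·d·X^{1/2}·log X. -/
lemma key1 (q a e x x' y y' : ℤ) (hq : 1 ≤ q) (hcop : IsCoprime q a)
    (hV : 3*a^2*e + 3*a*q*e^2 + q^2*e^3
      = q*((3*(a+q*e)*x' - 2*q*y') - (3*a*x - 2*q*y)))
    (hk : |3*((q^2*x' - (a+q*e)^2) - (q^2*x - a^2))| < q^2)
    (hg : |3*(q*e)| < q^3) : e = 0 ∧ x' = x ∧ y' = y := by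
  have h1 : q ∣ a^2 * (3*e) :=
    ⟨((3*(a+q*e)*x' - 2*q*y') - (3*a*x - 2*q*y)) - 3*a*e^2 - q*e^3, by linear_combination hV⟩
  have h2 : q ∣ 3*e := (hcop.pow_right (n := 2)).dvd_of_dvd_mul_left h1
  obtain ⟨t, ht⟩ := h2
  have hq0 : q ≠ 0 := by omega
  -- W
  set W := 3*(x'-x) - 2*a*t - q*e*t with hW
  have hkW : 3*((q^2*x' - (a+q*e)^2) - (q^2*x - a^2)) = q^2 * W := by
    rw [hW]; linear_combination (-2*a*q - q^2*e) * ht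
  have hW0 : W = 0 := by
    rw [hkW, abs_mul, abs_of_nonneg (sq_nonneg q)] at hk
    have : |W| < 1 := by
      have : (0:ℤ) < q^2 := by positivity
      nlinarith
    exact Int.abs_lt_one_iff.mp this
  have h3 : t*a^2 + a*q*t*e + q*e^3 = (3*(a+q*e)*x' - 2*q*y') - (3*a*x - 2*q*y) := by
    apply mul_left_cancel₀ hq0
    rw [← hV]; linear_combination (-a^2 - a*q*e) * ht
  have h4 : q ∣ a * (a * t) := by
    refine ⟨2*(y' - y)*(-1)*(-1) - 3*e*x' + a*t*e + e^3 - a*e*t, ?_⟩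
    have : 3*(x'-x) = 2*a*t + q*e*t := by linarith
    linear_combination (-1)*h3*(1) + (-a)*this*(-1)*(-1)
  have h5 : q ∣ t := by
    have := hcop.dvd_of_dvd_mul_left h4
    exact hcop.dvd_of_dvd_mul_left this
  have ht0 : t = 0 := by
    apply Int.eq_zero_of_abs_lt_dvd h5
    have e1 : 3*(q*e) = q^2*t := by linear_combination q*ht
    rw [e1, abs_mul, abs_of_nonneg (sq_nonneg q)] at hg
    have : (0:ℤ) < q^2 := by positivity
    nlinarith
  have he : e = 0 := by
    rw [ht0] at ht; omega
  subst ht0 he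
  have hx : x' = x := by simp at hW; omega
  subst hx
  refine ⟨rfl, rfl, ?_⟩
  have : q * (y' - y) = 0 := by nlinarith
  rcases mul_eq_zero.mp this with h | h
  · omega
  · omega

set_option maxHeartbeats 1000000 in
lemma key2 (q M a a' η η' D D' : ℝ) (hq : 1 ≤ q) (hM : 20 ≤ M) (hqM : q ≤ M)
    (ha' : 0 ≤ a') (ha2 : a' ≤ 2*q*M^2)
    (hη : |η| ≤ 1/M) (hη' : |η'| ≤ 1/M) (hs : 0 ≤ η * η')
    (hD : |D| ≤ 1/10000/M^2) (hD' : |D'| ≤ 1/10000/M^2)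
    (hE : 3*a'*η'^2+2*η'^3 - 2*q^3*D' = 3*a*η^2+2*η^3 - 2*q^3*D)
    (hg : 5000*|a'-a| ≤ q^3) :
    |3*((2*a'*η'+η'^2) - (2*a*η+η^2))| < q^2 := by
  have hM0 : 0 < M := by linarith
  have hη2 : η^2 ≤ 1/M^2 := by
    rw [← sq_abs]; calc |η|^2 ≤ (1/M)^2 := by gcongr
      _ = _ := by ring
  have hη2' : η'^2 ≤ 1/M^2 := by
    rw [← sq_abs]; calc |η'|^2 ≤ (1/M)^2 := by gcongr
      _ = _ := by ring
  have hMM : 1/M^2 ≤ 1/400 := by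
    apply one_div_le_one_div_of_le (by norm_num); nlinarith
  set z := |η' - η| with hz
  have hz0 : 0 ≤ z := abs_nonneg _
  have hz2 : z^2 ≤ |η'^2 - η^2| := by
    have : η'^2 - η^2 = (η'-η)*(η'+η) := by ring
    rw [this, abs_mul, sq]
    apply mul_le_mul_of_nonneg_left _ (abs_nonneg _)
    apply sq_le_sq.mp; nlinarith
  have hηη : η * η' ≤ 1/M^2 := by nlinarith [sq_nonneg (η - η')]
  have hc3 : |η'^3 - η^3| ≤ z * (3/M^2) := by
    have : η'^3 - η^3 = (η'-η)*(η'^2+η*η'+η^2) := by ring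
    rw [this, abs_mul]
    apply mul_le_mul_of_nonneg_left _ (abs_nonneg _)
    rw [abs_of_nonneg (by positivity)]
    have : 3/M^2 = 3*(1/M^2) := by ring
    linarith
  have hq3 : 0 < q^3 := by positivity
  have h1 : 3*a'*z^2 ≤ 4*q^3*(1/10000/M^2) + 3*(q^3/5000)*(1/M^2) + 2*(z*(3/M^2)) := by
    have e1 : 3*a'*(η'^2-η^2) = 2*q^3*(D'-D) - 3*((a'-a)*η^2) - 2*(η'^3-η^3) := by
      linear_combination hE
    have e2 : 3*a'*z^2 ≤ |3*a'*(η'^2-η^2)| := by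
      rw [abs_mul, abs_of_nonneg (by positivity : 0 ≤ 3*a')]
      gcongr
    have e3 : |2*q^3*(D'-D)| ≤ 4*q^3*(1/10000/M^2) := by
      rw [abs_mul, abs_of_nonneg (by positivity : 0 ≤ 2*q^3)]
      have : |D'-D| ≤ 2*(1/10000/M^2) := by
        calc _ ≤ |D'| + |D| := abs_sub _ _
          _ ≤ _ := by linarith
      nlinarith
    have e4 : |(a'-a)*η^2| ≤ (q^3/5000)*(1/M^2) := by
      rw [abs_mul, abs_of_nonneg (sq_nonneg η)]
      gcongr; linarith
    rw [e1] at e2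
    have e5 := abs_sub (2*q^3*(D'-D) - 3*((a'-a)*η^2)) (2*(η'^3-η^3))
    have e6 := abs_sub (2*q^3*(D'-D)) (3*((a'-a)*η^2))
    rw [abs_mul 2, abs_of_pos (by norm_num : (0:ℝ)<2)] at e5
    rw [abs_mul 3, abs_of_pos (by norm_num : (0:ℝ)<3)] at e6
    linarith
  set T := a'*z with hT
  have hT0 : 0 ≤ T := by positivity
  have h2 : 3*T^2 ≤ 0.002*q^4 + 6/400*T := by
    have e1 : 3*T^2 ≤ a' * (4*q^3*(1/10000/M^2) + 3*(q^3/5000)*(1/M^2)) + 6*T*(1/M^2) := by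
      have := mul_le_mul_of_nonneg_left h1 ha'
      calc 3*T^2 = a' * (3*a'*z^2) := by rw [hT]; ring
        _ ≤ _ := this
        _ = _ := by rw [hT]; ring
    have e2 : a' * (4*q^3*(1/10000/M^2) + 3*(q^3/5000)*(1/M^2)) ≤
        (2*q*M^2) * (4*q^3*(1/10000/M^2) + 3*(q^3/5000)*(1/M^2)) := by gcongr
    have e3 : (2*q*M^2) * (4*q^3*(1/10000/M^2) + 3*(q^3/5000)*(1/M^2)) = 0.002*q^4 := by
      field_simp; ring
    have e4 : 6*T*(1/M^2) ≤ 6*T*(1/400) := by gcongr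
    linarith
  have hq2 : 1 ≤ q^2 := by nlinarith
  have h3 : T ≤ q^2/20 := by
    by_contra hcon
    push Not at hcon
    have : q^4 = q^2*q^2 := by ring
    nlinarith
  have h4 : |(2*a'*η'+η'^2) - (2*a*η+η^2)| ≤ 2*T + 2*((q^3/5000)*(1/M)) + 2*(1/400) := by
    have e1 : (2*a'*η'+η'^2) - (2*a*η+η^2) = 2*(a'*(η'-η)) + 2*((a'-a)*η) + (η'^2 - η^2) := by ring
    have e2 : |a'*(η'-η)| = T := by rw [abs_mul, abs_of_nonneg ha']
    have e3 : |(a'-a)*η| ≤ (q^3/5000)*(1/M) := by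
      rw [abs_mul]; gcongr; linarith
    have e4 : |η'^2 - η^2| ≤ 2*(1/400) := by
      have i1 := sq_nonneg η; have i2 := sq_nonneg η'; rw [abs_le]; constructor <;> linarith
    rw [e1]
    have e5 := abs_add_le (2*(a'*(η'-η)) + 2*((a'-a)*η)) (η'^2 - η^2)
    have e6 := abs_add_le (2*(a'*(η'-η))) (2*((a'-a)*η))
    rw [abs_mul 2, abs_mul 2, abs_of_pos (by norm_num : (0:ℝ)<2)] at e6
    linarith
  have h5 : (q^3/5000)*(1/M) ≤ q^2/5000 := by
    rw [mul_one_div, div_le_iff₀ hM0]; nlinarith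
  rw [abs_mul, abs_of_pos (by norm_num : (0:ℝ)<3)]
  nlinarith

lemma approx (M : ℕ) (hM : 20 ≤ M) (x : ℤ) : ∃ (q : ℕ) (a : ℤ), 1 ≤ x → x ≤ (M:ℤ)^4 →
    (1 ≤ q ∧ q ≤ M ∧ IsCoprime (q:ℤ) a ∧ |q * √(x:ℝ) - a| ≤ 1/(M:ℝ) ∧ 0 ≤ a ∧
      (a:ℝ) ≤ 2*q*(M:ℝ)^2) := by
  obtain ⟨t, ht, htd⟩ := Real.exists_rat_abs_sub_le_and_den_le (√(x:ℝ)) (n := M) (by omega)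
  refine ⟨t.den, t.num, fun hx1 hx2 => ?_⟩
  have hM0 : (20:ℝ) ≤ M := by exact_mod_cast hM
  have hd : (1:ℝ) ≤ t.den := by exact_mod_cast t.den_pos
  have hη : |t.den * √(x:ℝ) - t.num| ≤ 1/(M:ℝ) := by
    have e : (t.den:ℝ) * √(x:ℝ) - t.num = t.den * (√(x:ℝ) - t) := by
      have : (t:ℝ) = t.num / t.den := by exact_mod_cast (Rat.num_div_den t).symm
      rw [this]; field_simp
    rw [e, abs_mul, abs_of_nonneg (by positivity)]
    calc _ ≤ (t.den:ℝ) * (1/((M+1)*t.den)) := by gcongr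
      _ = 1/(M+1) := by field_simp
      _ ≤ _ := by gcongr; linarith
  have hM1 : 1/(M:ℝ) ≤ 1/20 := by gcongr
  have hs1 : 1 ≤ √(x:ℝ) := by
    rw [Real.one_le_sqrt]; exact_mod_cast hx1
  have hs2 : √(x:ℝ) ≤ (M:ℝ)^2 := by
    apply Real.sqrt_le_iff.mpr
    refine ⟨by positivity, ?_⟩
    have : (x:ℝ) ≤ (M:ℝ)^4 := by exact_mod_cast hx2
    linarith [show ((M:ℝ)^2)^2 = (M:ℝ)^4 by ring]
  obtain ⟨h1, h2⟩ := abs_le.mp hη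
  refine ⟨t.den_pos, htd, ?_, hη, ?_, ?_⟩
  · rw [Int.isCoprime_iff_gcd_eq_one, Int.gcd_comm]
    exact t.reduced
  · have : (0:ℝ) < t.num := by nlinarith
    exact_mod_cast this.le
  · have : (t.den:ℝ) * √(x:ℝ) ≤ t.den * (M:ℝ)^2 := by gcongr
    nlinarith

lemma V_eq (q a x y : ℤ) (r s : ℝ) (hs : s^2 = x) :
    (a:ℝ)^3 + 2*q^3*r - q^2*((3*a*x - 2*q*y : ℤ):ℝ)
      = 3*a*(q*s-a)^2 + 2*(q*s-a)^3 - 2*q^3*(s^3 - (y+r)) := by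
  push_cast
  rw [← hs]; ring

set_option maxHeartbeats 1000000 in
lemma fibre (M q : ℕ) (hM : 20 ≤ M) (hq : 1 ≤ q) (hqM : q ≤ M) (r : ℝ) (a : ℤ → ℤ)
    (S : Finset (ℤ × ℤ))
    (hS : ∀ p ∈ S, 1 ≤ p.1 ∧ IsCoprime (q:ℤ) (a p.1) ∧
      |q * √(p.1:ℝ) - a p.1| ≤ 1/(M:ℝ) ∧ 0 ≤ a p.1 ∧ (a p.1:ℝ) ≤ 2*q*(M:ℝ)^2 ∧
      |√(p.1:ℝ)^3 - (p.2 + r)| ≤ 1/10000/(M:ℝ)^2) :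
    (S.card : ℝ) ≤ 200020*(M:ℝ)^2*(1/q) := by
  have hM0 : (20:ℝ) ≤ M := by exact_mod_cast hM
  have hq0 : (1:ℝ) ≤ q := by exact_mod_cast hq
  have hqM0 : (q:ℝ) ≤ M := by exact_mod_cast hqM
  have hqz : (1:ℤ) ≤ q := by exact_mod_cast hq
  let V : ℤ × ℤ → ℝ := fun p => ((a p.1:ℝ)^3 + 2*(q:ℝ)^3*r -
    (q:ℝ)^2*((3*a p.1*p.1 - 2*q*p.2 : ℤ):ℝ))/q
  let Φ : ℤ × ℤ → ℤ × ℤ × ℤ × Bool := fun p =>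
    (a p.1 % q, 5000 * a p.1 / (q:ℤ)^3, ⌊V p⌋, decide (0 ≤ q * √(p.1:ℝ) - a p.1))
  have hVE : ∀ p ∈ S, V p * q = 3*(a p.1)*(q*√(p.1:ℝ)-a p.1)^2 + 2*(q*√(p.1:ℝ)-a p.1)^3
      - 2*(q:ℝ)^3*(√(p.1:ℝ)^3 - (p.2+r)) := by
    intro p hp
    have h1 := (hS p hp).1
    have := V_eq q (a p.1) p.1 p.2 r (√(p.1:ℝ))
      (Real.sq_sqrt (by exact_mod_cast (by omega : 0 ≤ p.1)))
    simp only [V]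
    rw [div_mul_cancel₀ _ (by positivity)]
    push_cast at this ⊢
    linarith
  let Tg : Finset (ℤ × ℤ × ℤ × Bool) := Finset.Ico (0:ℤ) q ×ˢ
    (Finset.Icc (0:ℤ) (10000*(M:ℤ)^2/(q:ℤ)^2)) ×ˢ (Finset.Icc (-1:ℤ) 8) ×ˢ Finset.univ
  have hmaps : ∀ p ∈ S, Φ p ∈ Tg := by
    intro p hp
    obtain ⟨h1, h2, h3, h4, h5, h6⟩ := hS p hp
    have hV := hVE p hp
    simp only [Φ, Tg, Finset.mem_product, Finset.mem_Ico, Finset.mem_Icc, Finset.mem_univ, and_true]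
    refine ⟨⟨Int.emod_nonneg _ (by omega), Int.emod_lt_of_pos _ (by omega)⟩, ⟨?_, ?_⟩, ?_, ?_⟩
    · apply Int.ediv_nonneg <;> positivity
    · rw [Int.le_ediv_iff_mul_le (by positivity)]
      have e1 : 5000 * a p.1 / (q:ℤ)^3 * (q:ℤ)^3 ≤ 5000 * a p.1 :=
        Int.ediv_mul_le _ (by positivity)
      have e2 : a p.1 ≤ 2*q*(M:ℤ)^2 := by exact_mod_cast h5
      have e3 : (q:ℤ) * (5000 * a p.1 / (q:ℤ)^3 * (q:ℤ)^2) ≤ q * (10000*(M:ℤ)^2) := by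
        nlinarith
      exact le_of_mul_le_mul_left e3 (by omega)
    all_goals
      set η := q*√(p.1:ℝ)-a p.1 with hη
      set D := √(p.1:ℝ)^3 - (p.2+r) with hD
      have ha0 : (0:ℝ) ≤ a p.1 := by exact_mod_cast h4
      have hη2 : η^2 ≤ 1/(M:ℝ)^2 := by
        rw [← sq_abs]
        calc |η|^2 ≤ (1/(M:ℝ))^2 := by gcongr
          _ = _ := by ring
      have hM1 : 1/(M:ℝ) ≤ 1/20 := by gcongr
      have hηa := abs_le.mp h3
      have hDa := abs_le.mp h6
      have hqD : 2*(q:ℝ)^3*(1/10000/(M:ℝ)^2) ≤ q/5000 := by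
        have : (q:ℝ)^2 * (1/(M:ℝ)^2) ≤ 1 := by
          rw [mul_one_div, div_le_one (by positivity)]; gcongr
        calc _ = q/5000 * ((q:ℝ)^2 * (1/(M:ℝ)^2)) := by ring
          _ ≤ q/5000 * 1 := by gcongr
          _ = _ := by ring
      have hq3 : (0:ℝ) ≤ 2*(q:ℝ)^3 := by positivity
      have hqD1 := mul_le_mul_of_nonneg_left hDa.1 hq3
      have hqD2 := mul_le_mul_of_nonneg_left hDa.2 hq3
      have hMM : 1/(M:ℝ)^2 ≤ 1/400 := by
        apply one_div_le_one_div_of_le (by norm_num); nlinarith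
    · rw [Int.le_floor]
      push_cast
      have e1 : -((1:ℝ)/200) ≤ 3*(a p.1)*η^2 + 2*η^3 := by
        have : 0 ≤ (a p.1:ℝ)*η^2 := by positivity
        have : -((1:ℝ)/20) * η^2 ≤ η * η^2 := by gcongr; linarith
        have : η^3 = η*η^2 := by ring
        nlinarith
      by_contra hc
      push Not at hc
      have : V p * q < -1 * q := by gcongr
      linarith
    · apply Int.le_of_lt_add_one
      rw [Int.floor_lt]
      push_cast
      have e1 : 3*(a p.1)*η^2 + 2*η^3 ≤ 7*q := by
        have i1 : (a p.1:ℝ)*η^2 ≤ (2*q*(M:ℝ)^2)*(1/(M:ℝ)^2) := by gcongr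
        have i2 : (2*q*(M:ℝ)^2)*(1/(M:ℝ)^2) = 2*(q:ℝ) := by field_simp
        have : η * η^2 ≤ 1/20*η^2 := by gcongr; linarith
        have : η^3 = η*η^2 := by ring
        nlinarith
      by_contra hc
      push Not at hc
      have : (8+1:ℝ)*q ≤ V p * q := by
        apply mul_le_mul_of_nonneg_right _ (by positivity)
        linarith
      linarith
  have hinj : Set.InjOn Φ S := by
    intro p hp p' hp' heq
    obtain ⟨h1, h2, h3, h4, h5, h6⟩ := hS p hp
    obtain ⟨h1', h2', h3', h4', h5', h6'⟩ := hS p' hp'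
    have hV := hVE p hp
    have hV' := hVE p' hp'
    simp only [Φ, Prod.mk.injEq] at heq
    obtain ⟨c1, c2, c3, c4⟩ := heq
    obtain ⟨x, y⟩ := p
    obtain ⟨x', y'⟩ := p'
    dsimp only at *
    obtain ⟨e, he⟩ : (q:ℤ) ∣ a x' - a x := Int.ModEq.dvd c1
    have ha' : a x' = a x + q*e := by linarith
    have c2' : 5000 * |a x' - a x| ≤ (q:ℤ)^3 := by
      have hq3 : (0:ℤ) < (q:ℤ)^3 := by positivity
      have i1 := Int.emod_add_mul_ediv (5000 * a x) ((q:ℤ)^3)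
      have i2 := Int.emod_add_mul_ediv (5000 * a x') ((q:ℤ)^3)
      have i3 := Int.emod_nonneg (5000 * a x) hq3.ne'
      have i4 := Int.emod_nonneg (5000 * a x') hq3.ne'
      have i5 := Int.emod_lt_of_pos (5000 * a x) hq3
      have i6 := Int.emod_lt_of_pos (5000 * a x') hq3
      rw [← c2] at i2
      rcases abs_cases (a x' - a x) with ⟨h, _⟩ | ⟨h, _⟩ <;> rw [h] <;> linarith
    -- V equality
    have hdiff : (V (x',y') - V (x,y)) = ((3*(a x)^2*e + 3*(a x)*q*e^2 + (q:ℤ)^2*e^3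
        - q*((3*(a x+q*e)*x' - 2*q*y') - (3*a x*x - 2*q*y)) : ℤ):ℝ) := by
      simp only [V]
      rw [ha']
      push_cast
      field_simp
      ring
    have hlt : |V (x',y') - V (x,y)| < 1 := Int.abs_sub_lt_one_of_floor_eq_floor c3.symm
    have hZ : 3*(a x)^2*e + 3*(a x)*q*e^2 + (q:ℤ)^2*e^3
        - q*((3*(a x+q*e)*x' - 2*q*y') - (3*a x*x - 2*q*y)) = 0 := by
      rw [hdiff] at hlt
      apply Int.abs_lt_one_iff.mp
      exact_mod_cast hlt
    have hVV : V (x',y') = V (x,y) := by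
      rw [hZ] at hdiff
      push_cast at hdiff
      linarith
    rw [hVV, hV] at hV'
    have hsg : 0 ≤ (q*√(x:ℝ)-a x) * (q*√(x':ℝ)-a x') := by
      rw [decide_eq_decide] at c4
      by_cases hc : 0 ≤ q*√(x:ℝ)-a x
      · exact mul_nonneg hc (c4.mp hc)
      · have hc' := (not_congr c4).mp hc
        rw [not_le] at hc hc'
        exact (mul_pos_of_neg_of_neg hc hc').le
    have hk := key2 q M (a x) (a x') (q*√(x:ℝ)-a x) (q*√(x':ℝ)-a x')
      (√(x:ℝ)^3 - (y + r)) (√(x':ℝ)^3 - (y' + r)) hq0 hM0 hqM0 (by exact_mod_cast h4') h5'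
      h3 h3' hsg h6 h6' hV'.symm (by exact_mod_cast c2')
    have hsx : √(x:ℝ)^2 = x := Real.sq_sqrt (by exact_mod_cast (by omega : 0 ≤ x))
    have hsx' : √(x':ℝ)^2 = x' := Real.sq_sqrt (by exact_mod_cast (by omega : 0 ≤ x'))
    have hk2 : |3*(((q:ℤ)^2*x' - (a x+q*e)^2) - ((q:ℤ)^2*x - (a x)^2))| < (q:ℤ)^2 := by
      have e1 : (2*(a x':ℝ)*(q*√(x':ℝ)-a x')+(q*√(x':ℝ)-a x')^2) = (q:ℝ)^2*x' - (a x' :ℝ)^2 := by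
        linear_combination (q:ℝ)^2*hsx'
      have e2 : (2*(a x:ℝ)*(q*√(x:ℝ)-a x)+(q*√(x:ℝ)-a x)^2) = (q:ℝ)^2*x - (a x :ℝ)^2 := by
        linear_combination (q:ℝ)^2*hsx
      rw [e1, e2] at hk
      rw [← ha']
      exact_mod_cast hk
    have hg : |3*((q:ℤ)*e)| < (q:ℤ)^3 := by
      rw [← he, abs_mul]
      have hq3 : (0:ℤ) < (q:ℤ)^3 := by positivity
      have : |(3:ℤ)| = 3 := rfl
      rw [this]
      have := abs_nonneg (a x' - a x)
      omega
    obtain ⟨_, r1, r2⟩ := key1 q (a x) e x x' y y' hqz h2 (by linarith) hk2 hg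
    rw [r1, r2]
  have hcard : S.card ≤ Tg.card := Finset.card_le_card_of_injOn Φ hmaps hinj
  have hT : Tg.card = q * (((10000*(M:ℤ)^2/(q:ℤ)^2)+1).toNat * (10 * 2)) := by
    simp only [Tg, Finset.card_product, Int.card_Ico, Int.card_Icc]
    simp
  have hX : ((((10000*(M:ℤ)^2/(q:ℤ)^2)+1).toNat : ℕ):ℝ) ≤ 10001 * (M:ℝ)^2/(q:ℝ)^2 := by
    have n0 : (0:ℤ) ≤ (10000*(M:ℤ)^2/(q:ℤ)^2) := by positivity
    have e1 : ((((10000*(M:ℤ)^2/(q:ℤ)^2)+1).toNat : ℕ):ℝ)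
        = (((10000*(M:ℤ)^2/(q:ℤ)^2)+1 : ℤ):ℝ) := by
      rw [← Int.cast_natCast, Int.toNat_of_nonneg (by omega)]
    rw [e1, le_div_iff₀ (by positivity)]
    have e2 : (10000*(M:ℤ)^2/(q:ℤ)^2) * (q:ℤ)^2 ≤ 10000*(M:ℤ)^2 :=
      Int.ediv_mul_le _ (by positivity)
    have e3 : (q:ℤ)^2 ≤ (M:ℤ)^2 := by gcongr
    have e4 : (10000*(M:ℤ)^2/(q:ℤ)^2+1) * (q:ℤ)^2 ≤ 10001*(M:ℤ)^2 := by linarith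
    exact_mod_cast e4
  calc (S.card:ℝ) ≤ Tg.card := by exact_mod_cast hcard
    _ = q * (((((10000*(M:ℤ)^2/(q:ℤ)^2)+1).toNat : ℕ):ℝ) * (10 * 2)) := by
      rw [hT]; push_cast; ring
    _ ≤ q * ((10001 * (M:ℝ)^2/(q:ℝ)^2) * (10*2)) := by gcongr
    _ = _ := by field_simp; ring

lemma mainL (M : ℕ) (hM : 20 ≤ M) (r : ℝ) (S : Finset (ℤ × ℤ))
    (hS : ∀ p ∈ S, 1 ≤ p.1 ∧ p.1 ≤ (M:ℤ)^4 ∧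
      |√(p.1:ℝ)^3 - (p.2 + r)| ≤ 1/10000/(M:ℝ)^2) :
    (S.card : ℝ) ≤ 200020*(M:ℝ)^2*(1 + Real.log M) := by
  choose q a h using approx M hM
  have h1 : S.card = ∑ k ∈ Finset.Icc 1 M, (S.filter (fun p => q p.1 = k)).card := by
    apply Finset.card_eq_sum_card_fiberwise
    intro p hp
    obtain ⟨h1, h2, h3⟩ := hS p hp
    obtain ⟨g1, g2, _⟩ := h p.1 h1 h2
    simp [g1, g2]
  rw [h1]
  push_cast
  calc _ ≤ ∑ k ∈ Finset.Icc 1 M, 200020*(M:ℝ)^2*(1/(k:ℝ)) := by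
        apply Finset.sum_le_sum
        intro k hk
        rw [Finset.mem_Icc] at hk
        apply fibre M k hM hk.1 hk.2 r a
        intro p hp
        rw [Finset.mem_filter] at hp
        obtain ⟨hp, rfl⟩ := hp
        obtain ⟨h1, h2, h3⟩ := hS p hp
        obtain ⟨g1, g2, g3, g4, g5, g6⟩ := h p.1 h1 h2
        exact ⟨h1, g3, g4, g5, g6, h3⟩
    _ = 200020*(M:ℝ)^2 * ((harmonic M : ℚ):ℝ) := by
        rw [← Finset.mul_sum, harmonic_eq_sum_Icc]; push_cast; simp
    _ ≤ _ := by
        gcongr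
        exact harmonic_le_one_add_log M

lemma fin_bound (P R : ℕ) (hP : 1 ≤ P) (hR : 1 ≤ R) : ∃ C : ℝ, 0 < C ∧
    ∀ (r d : ℝ), 1 < d → ∀ X w : ℝ, 2 ≤ X → 1 ≤ w → w^4 = X → ∀ S : Finset (ℤ × ℤ),
    (∀ p ∈ S, 1 ≤ p.1 ∧ (p.1:ℝ) ≤ X ∧
      |√((P:ℝ) * p.1)^3 / R - (p.2 + r)| < d / w^2) →
    (S.card : ℝ) ≤ C * d * w^2 * Real.log X := by
  set A : ℝ := 22 * P with hA
  have hP1 : (1:ℝ) ≤ P := by exact_mod_cast hP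
  have hR1 : (1:ℝ) ≤ R := by exact_mod_cast hR
  have hA1 : 22 ≤ A := by linarith
  have hlA : 0 ≤ Real.log A := Real.log_nonneg (by linarith)
  refine ⟨(20003*R*A^2)*(200020*A^2*(3+2*Real.log A)), by positivity, ?_⟩
  intro r d hd X w hX hw hwX S hS
  set M : ℕ := ⌈(P:ℝ)*w⌉₊ + 20 with hMdef
  have hM20 : 20 ≤ M := by omega
  have hPw : (P:ℝ)*w ≤ M := by
    rw [hMdef]; push_cast; linarith [Nat.le_ceil ((P:ℝ)*w)]
  have hPw1 : 1 ≤ (P:ℝ)*w := by nlinarith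
  have hMA : (M:ℝ) ≤ A*w := by
    rw [hMdef, hA]; push_cast
    have := Nat.ceil_lt_add_one (by linarith : 0 ≤ (P:ℝ)*w)
    linarith
  have hM0 : (0:ℝ) < M := by exact_mod_cast (by omega : 0 < M)
  have hM2 : (M:ℝ)^2 ≤ A^2*w^2 := by rw [← mul_pow]; gcongr
  have hlogX : 1/2 ≤ Real.log X := by
    have := Real.log_two_gt_d9
    have := Real.log_le_log (by norm_num) hX
    linarith
  have hlog : 1 + Real.log M ≤ (3+2*Real.log A)*Real.log X := by
    have h1 : Real.log M ≤ Real.log (A*w) := Real.log_le_log hM0 hMA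
    rw [Real.log_mul (by linarith) (by linarith)] at h1
    have h2 : Real.log X = 4 * Real.log w := by
      rw [← hwX, Real.log_pow]; norm_num
    have h3 : 0 ≤ Real.log w := Real.log_nonneg hw
    nlinarith
  set h : ℝ := 1/10000/(M:ℝ)^2 with hh
  have hh0 : 0 < h := by positivity
  set K : ℕ := ⌈10000*R*A^2*d⌉₊ with hK
  have hKge : 10000*R*A^2*d ≤ K := Nat.le_ceil _
  have hRA : 1 ≤ R*A^2*d := by
    have : 1 ≤ A^2 := by nlinarith
    have : 1 ≤ (R:ℝ)*A^2 := by nlinarith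
    nlinarith
  have hKle : (K:ℝ) ≤ 10000*R*A^2*d + 1 := (Nat.ceil_lt_add_one (by positivity)).le
  let vv : ℤ × ℤ → ℝ := fun p => √((P:ℝ) * p.1)^3 - (R*p.2 + R*r)
  let ii : ℤ × ℤ → ℤ := fun p => ⌊vv p / h⌋
  have hvv : ∀ p ∈ S, |vv p| < K * h := by
    intro p hp
    obtain ⟨_, _, h3⟩ := hS p hp
    have e1 : vv p = R * (√((P:ℝ) * p.1)^3 / R - (p.2 + r)) := by
      simp only [vv]; field_simp
    rw [e1, abs_mul, abs_of_pos (by linarith)]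
    calc _ < R * (d/w^2) := by gcongr
      _ = (10000*R*A^2*d) * (1/10000/(A^2*w^2)) := by field_simp
      _ ≤ K * h := by rw [hh]; gcongr
  have hcard : S.card = ∑ i ∈ Finset.Icc (-(K:ℤ)) K, (S.filter (fun p => ii p = i)).card := by
    apply Finset.card_eq_sum_card_fiberwise
    intro p hp
    have hv := abs_lt.mp (hvv p hp)
    simp only [ii, Finset.coe_Icc, Set.mem_Icc]
    constructor
    · rw [Int.le_floor, le_div_iff₀ hh0]; push_cast; linarith
    · apply Int.le_of_lt_add_one
      rw [Int.floor_lt, div_lt_iff₀ hh0]; push_cast; nlinarith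
  have hfib : ∀ i ∈ Finset.Icc (-(K:ℤ)) K, ((S.filter (fun p => ii p = i)).card:ℝ) ≤
      200020*(M:ℝ)^2*(1 + Real.log M) := by
    intro i _
    let g : ℤ × ℤ → ℤ × ℤ := fun p => (P*p.1, R*p.2)
    have hg : Function.Injective g := by
      rintro ⟨x, y⟩ ⟨x', y'⟩ hxy
      simp only [g, Prod.mk.injEq] at hxy
      have hP0 : (P:ℤ) ≠ 0 := by exact_mod_cast (by omega : P ≠ 0)
      have hR0 : (R:ℤ) ≠ 0 := by exact_mod_cast (by omega : R ≠ 0)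
      rw [mul_left_cancel₀ hP0 hxy.1, mul_left_cancel₀ hR0 hxy.2]
    rw [← Finset.card_image_of_injective _ hg]
    apply mainL M hM20 (R*r + i*h)
    intro p hp
    rw [Finset.mem_image] at hp
    obtain ⟨⟨x, y⟩, hp, rfl⟩ := hp
    rw [Finset.mem_filter] at hp
    obtain ⟨hp, hi⟩ := hp
    obtain ⟨h1, h2, h3⟩ := hS _ hp
    dsimp only [g, ii] at *
    refine ⟨?_, ?_, ?_⟩
    · have : (1:ℤ) ≤ P := by exact_mod_cast hP
      nlinarith
    · have : (P:ℝ)*x ≤ (M:ℝ)^4 := by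
        have e1 : (P:ℝ) ≤ P^4 := le_self_pow₀ hP1 (by norm_num)
        calc (P:ℝ)*x ≤ P^4 * X := by
              have : (0:ℝ) ≤ x := by exact_mod_cast (by omega : 0 ≤ x)
              gcongr
          _ = (P*w)^4 := by rw [← hwX]; ring
          _ ≤ _ := by gcongr
      exact_mod_cast this
    · have f1 := Int.floor_le (vv (x,y) / h)
      have f2 := Int.lt_floor_add_one (vv (x,y) / h)
      rw [hi, le_div_iff₀ hh0] at f1
      rw [hi, div_lt_iff₀ hh0] at f2
      simp only [vv] at f1 f2
      push_cast
      rw [abs_le]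
      constructor <;> linarith
  rw [hcard]
  push_cast
  calc _ ≤ ∑ i ∈ Finset.Icc (-(K:ℤ)) K, 200020*(M:ℝ)^2*(1 + Real.log M) :=
        Finset.sum_le_sum hfib
    _ = (2*K+1) * (200020*(M:ℝ)^2*(1 + Real.log M)) := by
        rw [Finset.sum_const, Int.card_Icc, nsmul_eq_mul]
        congr 1
        have : ((K:ℤ) + 1 - -(K:ℤ)).toNat = 2*K+1 := by omega
        rw [this]; push_cast; ring
    _ ≤ (20003*R*A^2*d) * (200020*(A^2*w^2)*((3+2*Real.log A)*Real.log X)) := by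
        have hl0 : 0 ≤ 1 + Real.log M := by
          have : 0 ≤ Real.log M := Real.log_natCast_nonneg M
          linarith
        have : (2*K+1:ℝ) ≤ 20003*R*A^2*d := by nlinarith
        gcongr
    _ = _ := by ring

/-- For each positive rational `c` there is a constant `C > 0` such that for every real shift
`r`, every `d > 1` and every `X ≥ 2`, the number of integer pairs `(x, y)` with `1 ≤ x ≤ X` and
`|√(c x³) - (y + r)| < d X^{-1/2}` is at most `C d X^{1/2} log X`. -/
theorem count_near_integer_multiples_of_c_x_pow_three_halves (c : ℚ) (hc : 0 < c) :
    ∃ C : ℝ, 0 < C ∧ ∀ (r : ℝ) (d : ℝ), 1 < d → ∀ X : ℝ, 2 ≤ X →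
      (Nat.card {p : ℤ × ℤ // 1 ≤ p.1 ∧ (p.1 : ℝ) ≤ X ∧
          |Real.sqrt ((c : ℝ) * (p.1 : ℝ) ^ 3) - ((p.2 : ℝ) + r)| <
            d * X ^ (-(1 : ℝ) / 2)} : ℝ) ≤
        C * d * X ^ ((1 : ℝ) / 2) * Real.log X := by
  set u : ℕ := c.num.toNat with hu
  set v : ℕ := c.den with hv
  have hnum : 0 < c.num := Rat.num_pos.mpr hc
  have hu1 : 1 ≤ u := by omega
  have hv1 : 1 ≤ v := c.den_pos
  have hcu : (c:ℝ) = (u:ℝ)/v := by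
    have h1 : (c:ℝ) = (c.num:ℝ) / (c.den:ℝ) := by exact_mod_cast (Rat.num_div_den c).symm
    have h2 : ((u:ℕ):ℝ) = (c.num:ℝ) := by
      have : ((u:ℕ):ℤ) = c.num := by omega
      exact_mod_cast this
    rw [h1, h2]
  obtain ⟨C, hC, hmain⟩ := fin_bound (u*v) (u*v^2) (Nat.mul_pos hu1 hv1)
    (Nat.mul_pos hu1 (pow_pos hv1 2))
  refine ⟨C, hC, ?_⟩
  intro r d hd X hX
  have hX0 : 0 ≤ X := by linarith
  set w : ℝ := X ^ ((1:ℝ)/4) with hw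
  have hw1 : 1 ≤ w := Real.one_le_rpow (by linarith) (by norm_num)
  have hw4 : w^4 = X := by
    rw [hw, ← Real.rpow_natCast, ← Real.rpow_mul hX0]; norm_num
  have hw2 : X ^ ((1:ℝ)/2) = w^2 := by
    rw [hw, ← Real.rpow_natCast, ← Real.rpow_mul hX0]; norm_num
  have hwm : d * X ^ (-(1:ℝ)/2) = d / w^2 := by
    rw [← hw2, neg_div, Real.rpow_neg hX0]
    exact (div_eq_mul_inv _ _).symm
  rw [hw2, hwm]
  set s : Set (ℤ × ℤ) := {p | 1 ≤ p.1 ∧ (p.1 : ℝ) ≤ X ∧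
          |Real.sqrt ((c : ℝ) * (p.1 : ℝ) ^ 3) - ((p.2 : ℝ) + r)| < d / w^2} with hs
  change (Nat.card s : ℝ) ≤ _
  by_cases hfin : s.Finite
  · have : Nat.card s = hfin.toFinset.card := by
      rw [← Set.ncard_eq_toFinset_card s hfin]; rfl
    rw [this]
    apply hmain r d hd X w hX hw1 hw4
    intro p hp
    rw [Set.Finite.mem_toFinset] at hp
    obtain ⟨h1, h2, h3⟩ := hp
    refine ⟨h1, h2, ?_⟩
    have hx0 : (0:ℝ) ≤ p.1 := by exact_mod_cast (by omega : 0 ≤ p.1)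
    have hup : (0:ℝ) < u := by exact_mod_cast hu1
    have hvp : (0:ℝ) < v := by exact_mod_cast hv1
    have e : √((c:ℝ) * (p.1:ℝ)^3) = √(((u*v:ℕ):ℝ) * p.1)^3 / ((u*v^2:ℕ):ℝ) := by
      push_cast
      rw [Real.sqrt_eq_iff_mul_self_eq (by rw [hcu]; positivity) (by positivity)]
      have hsq : √((u:ℝ)*v*p.1)^2 = (u:ℝ)*v*p.1 := Real.sq_sqrt (by positivity)
      symm
      calc _ = (√((u:ℝ)*v*p.1)^2)^3 / (u*v^2)^2 := by ring
        _ = _ := by rw [hsq, hcu]; field_simp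
    rw [← e]; exact h3
  · have : Nat.card s = 0 := by
      have := Set.not_finite.mp hfin
      exact Set.Infinite.card_eq_zero this
    rw [this]
    have : 0 ≤ Real.log X := Real.log_nonneg (by linarith)
    push_cast
    positivity
end

section
/- For each real constant C₁ > 0 there exists a constant C₂ > 0 such that for every real X ≥ 2, the number of pairs of positive integers (x, y) with x ≤ X and |x³ − y²| ≤ C₁·x is at most C₂·X^{1/2}·log X. -/
lemma spread_card (S : Finset ℤ) (D c : ℤ) (hD : 0 < D) (hc : 0 < c) (a H : ℝ) (hH : 0 ≤ H)
    (hS : ∀ s ∈ S, a ≤ (s:ℝ) ∧ (s:ℝ) ≤ a + H) (hd : ∀ s ∈ S, ∀ t ∈ S, D ∣ c * (s - t)) :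
    (S.card : ℝ) ≤ 1 + c * H / D := by
  have hD' : (0:ℝ) < D := by exact_mod_cast hD
  have hc' : (0:ℝ) < c := by exact_mod_cast hc
  have hq : 0 ≤ (c:ℝ) * H / D := by positivity
  rcases S.eq_empty_or_nonempty with rfl | hne
  · simp; linarith
  set s0 := S.min' hne with hs0
  have hs0m : s0 ∈ S := S.min'_mem hne
  have hcard : S.card ≤ (Finset.Icc (0:ℤ) ⌊(c:ℝ) * H / D⌋).card := by
    apply Finset.card_le_card_of_injOn (fun s => c * (s - s0) / D)
    · intro s hs
      have hs : s ∈ S := hs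
      have h1 : s0 ≤ s := S.min'_le s hs
      obtain ⟨k, hk⟩ := hd s hs s0 hs0m
      have : c * (s - s0) / D = k := by rw [hk]; exact Int.mul_ediv_cancel_left _ hD.ne'
      simp only [this, Finset.coe_Icc, Set.mem_Icc]
      constructor
      · by_contra hk0
        push Not at hk0
        nlinarith [mul_nonneg hc.le (sub_nonneg.2 h1)]
      · rw [Int.le_floor, le_div_iff₀ hD']
        have : (c:ℝ) * (s - s0) = D * k := by exact_mod_cast hk
        have h3 := hS s hs
        have h4 := hS s0 hs0m
        nlinarith
    · intro s hs t ht hst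
      obtain ⟨k, hk⟩ := hd s hs s0 hs0m
      obtain ⟨l, hl⟩ := hd t ht s0 hs0m
      simp only [hk, hl] at hst
      rw [Int.mul_ediv_cancel_left _ hD.ne', Int.mul_ediv_cancel_left _ hD.ne'] at hst
      subst hst
      have := mul_left_cancel₀ hc.ne' (hk.trans hl.symm)
      linarith
  rw [Int.card_Icc] at hcard
  have hf : 0 ≤ ⌊(c:ℝ) * H / D⌋ := Int.floor_nonneg.2 hq
  have : (S.card : ℤ) ≤ ⌊(c:ℝ) * H / D⌋ + 1 := by omega
  have h2 : (S.card : ℝ) ≤ ⌊(c:ℝ) * H / D⌋ + 1 := by exact_mod_cast this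
  have := Int.floor_le ((c:ℝ) * H / D)
  linarith

lemma fiber_card {α β : Type*} [DecidableEq α] [DecidableEq β] (S : Finset α) (f : α → β) (A B : ℝ)
    (hB0 : 0 ≤ B)
    (hA : ((S.image f).card : ℝ) ≤ A) (hB : ∀ b ∈ S.image f, ((S.filter (fun a => f a = b)).card : ℝ) ≤ B) :
    (S.card : ℝ) ≤ A * B := by
  rw [Finset.card_eq_sum_card_image f S]
  push_cast
  calc _ ≤ ∑ b ∈ S.image f, B := Finset.sum_le_sum hB
    _ = (S.image f).card * B := by simp
    _ ≤ A * B := by gcongr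

def mmv (q : ℤ) (t : ℤ × ℤ × ℤ) : ℤ := t.1^3 - 3*t.2.1*t.1*q^2+2*t.2.2*q^3
def sgv (q : ℤ) (t : ℤ × ℤ × ℤ) : ℤ := t.2.1*q^2 - t.1^2

lemma div2 {q : ℤ} {s t : ℤ × ℤ × ℤ} (hc : IsCoprime q s.1) (hr : q ∣ s.1 - t.1)
    (hm : mmv q s = mmv q t) : q^2 ∣ 3 * (s.1 - t.1) := by
  obtain ⟨k, hk⟩ := hr
  have hcop : IsCoprime (q^2) (s.1^2) := hc.pow
  apply hcop.dvd_of_dvd_mul_left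
  unfold mmv at hm
  obtain ⟨p, x, y⟩ := s
  obtain ⟨p', x', y'⟩ := t
  simp only at *
  obtain rfl : p' = p - q * k := by linarith
  refine ⟨3 * p * k^2 - q * k^3 + 3*x*p - 2*y*q - 3 * x' * (p-q*k) + 2 * y' * q, ?_⟩
  linear_combination hm

lemma div3 {q : ℤ} {s t : ℤ × ℤ × ℤ} (hq : q ≠ 0) (hc : IsCoprime q s.1) (hr : q ∣ s.1 - t.1)
    (hm : mmv q s = mmv q t) (hs : sgv q s = sgv q t) : q^3 ∣ 3 * (s.1 - t.1) := by
  obtain ⟨l, hl⟩ := div2 hc hr hm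
  obtain ⟨k, hk⟩ := hr
  have hcop : IsCoprime (q^3) (s.1^2) := hc.pow
  apply hcop.dvd_of_dvd_mul_left
  unfold mmv at hm
  unfold sgv at hs
  obtain ⟨p, x, y⟩ := s
  obtain ⟨p', x', y'⟩ := t
  simp only at *
  obtain rfl : p' = p - q * k := by linarith
  have hl' : 3 * k = q * l := by
    apply mul_left_cancel₀ hq
    linarith
  refine ⟨2 * p * k * l - 2 * k^3 - 3 * x * k + 2 * y - 2 * y', ?_⟩
  have e : q * k * (3 * p^2 - 6 * p * (q * k) + 2 * (q*k)^2 + 3 * q^2 * x) = 2 * y * q^3 - 2 * y' * q^3 := by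
    linear_combination (-1) * hm - 3 * (p - q * k) * hs
  linear_combination e + 2 * p * k * q^2 * hl'

lemma divs {q : ℤ} {s t : ℤ × ℤ × ℤ} (hc : IsCoprime q s.1) (hr : q ∣ s.1 - t.1)
    (hm : mmv q s = mmv q t) : q^2 ∣ 9 * (sgv q s - sgv q t) := by
  obtain ⟨l, hl⟩ := div2 hc hr hm
  unfold sgv
  refine ⟨9 * (s.2.1 - t.2.1) - 3 * l * (s.1 + t.1), ?_⟩
  linear_combination (-3) * (s.1 + t.1) * hl

lemma inj {q : ℤ} {s t : ℤ × ℤ × ℤ} (hq : q ≠ 0) (hp : s.1 = t.1)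
    (hm : mmv q s = mmv q t) (hs : sgv q s = sgv q t) : s = t := by
  unfold mmv at hm
  unfold sgv at hs
  obtain ⟨p, x, y⟩ := s
  obtain ⟨p', x', y'⟩ := t
  simp only at *
  subst hp
  have hx : x = x' := by
    have : x * q^2 = x' * q^2 := by linarith
    exact mul_right_cancel₀ (pow_ne_zero 2 hq) this
  subst hx
  have : y * q^3 = y' * q^3 := by linarith
  rw [mul_right_cancel₀ (pow_ne_zero 3 hq) this]

lemma core0 (q : ℤ) (hq : 1 ≤ q) (S : Finset (ℤ × ℤ × ℤ)) (m : ℤ) (R H : ℝ) (hR : 0 ≤ R) (hH : 0 ≤ H)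
    (a : ℤ → ℝ)
    (hc : ∀ t ∈ S, IsCoprime q t.1) (hm : ∀ t ∈ S, mmv q t = m)
    (hr : ∀ s ∈ S, ∀ t ∈ S, q ∣ s.1 - t.1)
    (hs : ∀ t ∈ S, |(sgv q t : ℝ)| ≤ R)
    (hp : ∀ t ∈ S, a (sgv q t) ≤ (t.1:ℝ) ∧ (t.1:ℝ) ≤ a (sgv q t) + H) :
    (S.card : ℝ) ≤ (1 + 18 * R / q^2) * (1 + 3 * H / q^3) := by
  have hq0 : 0 < q := by linarith
  have hq' : (0:ℝ) < q := by exact_mod_cast hq0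
  apply fiber_card S (sgv q)
  · positivity
  · have := spread_card (S.image (sgv q)) (q^2) 9 (by positivity) (by norm_num) (-R) (2*R) (by linarith)
      (by
        intro s hs'
        obtain ⟨t, ht, rfl⟩ := Finset.mem_image.1 hs'
        have := abs_le.1 (hs t ht)
        constructor <;> linarith)
      (by
        intro s hs' s' hs''
        obtain ⟨t, ht, rfl⟩ := Finset.mem_image.1 hs'
        obtain ⟨t', ht', rfl⟩ := Finset.mem_image.1 hs''
        exact divs (hc t ht) (hr t ht t' ht') ((hm t ht).trans (hm t' ht').symm))
    push_cast at this
    convert this using 3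
    ring
  · intro b hb
    set F := S.filter (fun t => sgv q t = b) with hF
    have hcard : (F.image Prod.fst).card = F.card := by
      apply Finset.card_image_of_injOn
      intro s hs' t ht' hst
      have hs' := Finset.mem_filter.1 hs'
      have ht' := Finset.mem_filter.1 ht'
      exact inj hq0.ne' hst ((hm s hs'.1).trans (hm t ht'.1).symm) (hs'.2.trans ht'.2.symm)
    rw [← hcard]
    have := spread_card (F.image Prod.fst) (q^3) 3 (by positivity) (by norm_num) (a b) H hH
      (by
        intro s hs'
        obtain ⟨t, ht, rfl⟩ := Finset.mem_image.1 hs'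
        have ht := Finset.mem_filter.1 ht
        have h := hp t ht.1
        rw [ht.2] at h
        exact h)
      (by
        intro s hs' s' hs''
        obtain ⟨t, ht, rfl⟩ := Finset.mem_image.1 hs'
        obtain ⟨t', ht', rfl⟩ := Finset.mem_image.1 hs''
        have ht := Finset.mem_filter.1 ht
        have ht' := Finset.mem_filter.1 ht'
        exact div3 hq0.ne' (hc t ht.1) (hr t ht.1 t' ht'.1) ((hm t ht.1).trans (hm t' ht'.1).symm)
          (ht.2.trans ht'.2.symm))
    push_cast at this
    exact this

lemma core1 (K Q : ℝ) (hK : 1 ≤ K) (q : ℤ) (hq : 1 ≤ q) (hqQ : (q:ℝ) ≤ Q)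
    (S : Finset (ℤ × ℤ × ℤ)) (m : ℤ)
    (hc : ∀ t ∈ S, IsCoprime q t.1) (hm : ∀ t ∈ S, mmv q t = m)
    (hr : ∀ s ∈ S, ∀ t ∈ S, q ∣ s.1 - t.1)
    (hp : ∀ t ∈ S, 0 < t.1 ∧ (t.1:ℝ) ≤ 5 * q * Q^2)
    (hmK : |(m:ℝ)| ≤ K * q)
    (he : ∀ t ∈ S, |4 * (m:ℝ) * t.1 - 3 * (sgv q t : ℝ)^2| ≤ K * q^4) :
    (S.card : ℝ) ≤ 400 * K * (20 + K) * (Q^2 / q^2) := by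
  have hq0 : 0 < q := by linarith
  have hq1 : (1:ℝ) ≤ q := by exact_mod_cast hq
  have hq' : (0:ℝ) < q := by exact_mod_cast hq0
  have hQ : 0 < Q := by linarith
  set M := |(m:ℝ)| with hM
  have hM0 : 0 ≤ M := abs_nonneg _
  have hsig : ∀ t ∈ S, (sgv q t : ℝ)^2 ≤ 20 * q * Q^2 * M + K * q^4 := by
    intro t ht
    have h1 := abs_le.1 (he t ht)
    have h2 : (m:ℝ) * t.1 ≤ M * (5 * q * Q^2) := by
      have h3 : (0:ℝ) < t.1 := by exact_mod_cast (hp t ht).1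
      calc (m:ℝ) * t.1 ≤ M * t.1 := by gcongr; exact le_abs_self _
        _ ≤ _ := by gcongr; exact (hp t ht).2
    nlinarith [sq_nonneg (sgv q t : ℝ)]
  have hr1 : 1 ≤ Q^2/q^2 := by
    rw [one_le_div (by positivity)]
    gcongr
  by_cases hcase : M * Q^2 ≤ q^3
  · have := core0 q hq S m ((20+K) * q^2) (5 * q * Q^2) (by positivity) (by positivity) (fun _ => 0)
      hc hm hr
      (by
        intro t ht
        apply abs_le_of_sq_le_sq _ (by positivity)
        have h1 := hsig t ht
        have h2 : q * (M * Q^2) ≤ q * (q:ℝ)^3 := by gcongr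
        have h3 : (20 + K) * (q:ℝ)^4 ≤ (20+K) * (20+K) * q^4 := by
          have : 0 ≤ (20+K) * (q:ℝ)^4 := by positivity
          nlinarith
        nlinarith)
      (by
        intro t ht
        have h3 : (0:ℝ) < t.1 := by exact_mod_cast (hp t ht).1
        simp only [zero_add]
        exact ⟨h3.le, (hp t ht).2⟩)
    refine this.trans ?_
    have e1 : 18 * ((20+K) * (q:ℝ)^2) / q^2 = 18 * (20+K) := by field_simp
    have e2 : 3 * (5 * q * Q^2) / (q:ℝ)^3 = 15 * (Q^2/q^2) := by field_simp; norm_num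
    rw [e1, e2]
    calc (1 + 18 * (20+K)) * (1 + 15 * (Q^2/q^2)) ≤ (19 * (20 + K)) * (16 * (Q^2/q^2)) := by
          gcongr <;> linarith
      _ = 304 * 1 * (20+K) * (Q^2/q^2) := by ring
      _ ≤ _ := by gcongr; norm_num
  · push Not at hcase
    have hMpos : 0 < M := by
      by_contra h
      have : M = 0 := by linarith
      rw [this] at hcase
      have : (0:ℝ) < q^3 := by positivity
      linarith
    have hm0 : (m:ℝ) ≠ 0 := abs_pos.1 hMpos
    set w := Real.sqrt (q * M) with hw
    have hw2 : w^2 = q * M := Real.sq_sqrt (by positivity)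
    have hwpos : 0 < w := Real.sqrt_pos.2 (by positivity)
    have hwQ : (q:ℝ)^2 ≤ w * Q := by
      refine (le_abs_self _).trans (abs_le_of_sq_le_sq ?_ (by positivity))
      calc ((q:ℝ)^2)^2 = q * q^3 := by ring
        _ ≤ q * (M * Q^2) := by gcongr
        _ = (w*Q)^2 := by rw [mul_pow, hw2]; ring
    have := core0 q hq S m ((20+K) * (w * Q)) (K * q^4 / (2 * M)) (by positivity) (by positivity)
      (fun σ => 3 * (σ:ℝ)^2 / (4 * m) - K * q^4 / (4 * M))
      hc hm hr
      (by
        intro t ht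
        apply abs_le_of_sq_le_sq _ (by positivity)
        have h1 := hsig t ht
        have h2 : ((q:ℝ)^2)^2 ≤ (w * Q)^2 := by gcongr
        have h4 : (w*Q)^2 = q * M * Q^2 := by rw [mul_pow, hw2]
        have h3 : (20 + K) * (w*Q)^2 ≤ (20+K) * (20+K) * (w*Q)^2 := by
          have : 0 ≤ (20+K) * (w*Q)^2 := by positivity
          nlinarith
        have h5 : K * ((q:ℝ)^2)^2 ≤ K * (w * Q)^2 := by gcongr
        nlinarith)
      (by
        intro t ht
        have h1 := he t ht
        have h2 : |(t.1:ℝ) - 3 * (sgv q t:ℝ)^2 / (4 * m)| ≤ K * q^4 / (4 * M) := by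
          have : (t.1:ℝ) - 3 * (sgv q t:ℝ)^2 / (4 * m) = (4 * (m:ℝ) * t.1 - 3 * (sgv q t : ℝ)^2) / (4 * m) := by
            field_simp
          rw [this, abs_div, abs_mul, ← hM]
          norm_num
          gcongr
        have h3 := abs_le.1 h2
        have h4 : K * q^4 / (2 * M) = K * q^4 / (4 * M) + K * q^4 / (4 * M) := by field_simp; norm_num
        rw [h4]
        constructor <;> linarith [h3.1, h3.2])
    refine this.trans ?_
    have e1 : 1 + 18 * ((20+K) * (w*Q)) / (q:ℝ)^2 ≤ 19 * (20+K) * (w * Q / q^2) := by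
      have : 1 ≤ w * Q / (q:ℝ)^2 := by rw [one_le_div (by positivity)]; exact hwQ
      have h2 : 18 * ((20+K) * (w*Q)) / (q:ℝ)^2 = 18 * (20+K) * (w * Q / q^2) := by ring
      rw [h2]
      nlinarith
    have e2 : 1 + 3 * (K * q^4 / (2 * M)) / (q:ℝ)^3 ≤ 3 * (K * q / M) := by
      have h1 : 1 ≤ K * q / M := by rw [one_le_div hMpos]; exact hmK
      have h2 : 3 * (K * q^4 / (2 * M)) / (q:ℝ)^3 = 3 / 2 * (K * q / M) := by field_simp
      rw [h2]; linarith
    have e3 : Q / w ≤ Q^2 / q^2 := by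
      rw [div_le_div_iff₀ hwpos (by positivity)]
      nlinarith
    calc _ ≤ (19 * (20+K) * (w * Q / q^2)) * (3 * (K * q / M)) := by gcongr
      _ = 57 * K * (20+K) * (w * Q / (q * M)) := by field_simp; norm_num
      _ = 57 * K * (20+K) * (Q / w) := by rw [← hw2]; field_simp
      _ ≤ 400 * K * (20+K) * (Q^2/q^2) := by gcongr; norm_num

lemma core2 (K Q : ℝ) (hK : 1 ≤ K) (q : ℤ) (hq : 1 ≤ q) (hqQ : (q:ℝ) ≤ Q)
    (S : Finset (ℤ × ℤ × ℤ))
    (hc : ∀ t ∈ S, IsCoprime q t.1)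
    (hp : ∀ t ∈ S, 0 < t.1 ∧ (t.1:ℝ) ≤ 5 * q * Q^2)
    (hmK : ∀ t ∈ S, |(mmv q t:ℝ)| ≤ K * q)
    (he : ∀ t ∈ S, |4 * (mmv q t:ℝ) * t.1 - 3 * (sgv q t : ℝ)^2| ≤ K * q^4) :
    (S.card : ℝ) ≤ (1 + 2 * K) * (400 * K * (20 + K)) * (Q^2 / q) := by
  have hq0 : 0 < q := by linarith
  have hq' : (0:ℝ) < q := by exact_mod_cast hq0
  have hQ : 0 < Q := by linarith
  have key : (S.card : ℝ) ≤ q * ((1 + 2 * K) * (400 * K * (20 + K) * (Q^2 / q^2))) := by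
    apply fiber_card S (fun t => t.1 % q)
    · positivity
    · have : (S.image (fun t => t.1 % q)) ⊆ Finset.Ico 0 q := by
        intro r hr
        obtain ⟨t, ht, rfl⟩ := Finset.mem_image.1 hr
        exact Finset.mem_Ico.2 ⟨Int.emod_nonneg _ hq0.ne', Int.emod_lt_of_pos _ hq0⟩
      have h := Finset.card_le_card this
      rw [Int.card_Ico] at h
      have : ((S.image (fun t => t.1 % q)).card : ℤ) ≤ q := by omega
      exact_mod_cast this
    · intro r hr
      set F := S.filter (fun t => t.1 % q = r) with hF
      have hFS : ∀ t ∈ F, t ∈ S := fun t ht => (Finset.mem_filter.1 ht).1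
      have hFr : ∀ s ∈ F, ∀ t ∈ F, q ∣ s.1 - t.1 := by
        intro s hs t ht
        have h1 := (Finset.mem_filter.1 hs).2
        have h2 := (Finset.mem_filter.1 ht).2
        exact Int.ModEq.dvd (h2.trans h1.symm)
      apply fiber_card F (mmv q)
      · positivity
      · have := spread_card (F.image (mmv q)) q 1 hq0 (by norm_num) (-(K * q)) (2 * (K * q)) (by positivity)
          (by
            intro s hs'
            obtain ⟨t, ht, rfl⟩ := Finset.mem_image.1 hs'
            have := abs_le.1 (hmK t (hFS t ht))
            constructor <;> linarith)
          (by
            intro s hs' s' hs''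
            obtain ⟨t, ht, rfl⟩ := Finset.mem_image.1 hs'
            obtain ⟨t', ht', rfl⟩ := Finset.mem_image.1 hs''
            obtain ⟨k, hk⟩ := hFr t ht t' ht'
            unfold mmv
            refine ⟨k * (t.1^2 + t.1 * t'.1 + t'.1^2) - 3*t.2.1*t.1*q+2*t.2.2*q^2
              + 3*t'.2.1*t'.1*q-2*t'.2.2*q^2, ?_⟩
            linear_combination (t.1^2 + t.1 * t'.1 + t'.1^2) * hk)
        refine this.trans (le_of_eq ?_)
        push_cast
        field_simp
      · intro m hm
        obtain ⟨t0, ht0, rfl⟩ := Finset.mem_image.1 hm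
        have hG : ∀ t ∈ F.filter (fun t => mmv q t = mmv q t0), t ∈ S := fun t ht =>
          hFS t (Finset.mem_filter.1 ht).1
        apply core1 K Q hK q hq hqQ _ (mmv q t0)
        · exact fun t ht => hc t (hG t ht)
        · exact fun t ht => (Finset.mem_filter.1 ht).2
        · exact fun s hs t ht => hFr s (Finset.mem_filter.1 hs).1 t (Finset.mem_filter.1 ht).1
        · exact fun t ht => hp t (hG t ht)
        · exact hmK t0 (hFS t0 ht0)
        · intro t ht
          have := he t (hG t ht)
          rwa [(Finset.mem_filter.1 ht).2] at this
  refine key.trans (le_of_eq ?_)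
  field_simp

set_option maxHeartbeats 800000 in
lemma approx_s19 (C : ℝ) (hC : 0 < C) (Q : ℕ) (hQ : 1 ≤ Q) (x y : ℤ) (hx : 0 < x) (hy : 0 < y)
    (hx1 : (Q:ℝ)^4 ≤ x) (hx2 : (x:ℝ) ≤ 16 * (Q:ℝ)^4) (h : |(x:ℝ)^3 - (y:ℝ)^2| ≤ C * x) :
    ∃ q p : ℤ, 1 ≤ q ∧ q ≤ (Q:ℤ) ∧ IsCoprime q p ∧ 0 < p ∧ (p:ℝ) ≤ 5 * q * (Q:ℝ)^2 ∧
      |(mmv q (p,x,y):ℝ)| ≤ (24 + 40 * C) * q ∧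
      |4 * (mmv q (p,x,y):ℝ) * p - 3 * (sgv q (p,x,y) : ℝ)^2| ≤ (24 + 40 * C) * q^4 := by
  obtain ⟨r, hr, hrd⟩ := Real.exists_rat_abs_sub_le_and_den_le (Real.sqrt x) (n := Q) (by omega)
  have hxr : (0:ℝ) < x := by exact_mod_cast hx
  have hyr : (0:ℝ) < y := by exact_mod_cast hy
  set w := Real.sqrt x with hw
  have hw2 : w^2 = x := Real.sq_sqrt hxr.le
  have hwpos : 0 < w := Real.sqrt_pos.2 hxr
  have hQr : (1:ℝ) ≤ Q := by exact_mod_cast hQ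
  have hwl : (Q:ℝ)^2 ≤ w := by
    apply Real.le_sqrt_of_sq_le
    nlinarith
  have hwu : w ≤ 4 * (Q:ℝ)^2 := by
    apply Real.sqrt_le_iff.2
    constructor
    · positivity
    · nlinarith
  set q : ℤ := (r.den : ℤ) with hq
  set p : ℤ := r.num with hp
  have hqpos : 1 ≤ q := by have := r.den_pos; omega
  have hqQ : q ≤ (Q:ℤ) := by omega
  have hqr : (1:ℝ) ≤ q := by exact_mod_cast hqpos
  have hqQr : (q:ℝ) ≤ Q := by exact_mod_cast hqQ
  have hq0 : (0:ℝ) < q := by linarith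
  have hcop : IsCoprime q p := by
    rw [Int.isCoprime_iff_gcd_eq_one]
    have := r.reduced
    rw [Int.gcd_comm]
    simpa [Int.gcd, hq, hp] using this
  set α : ℝ := p - q * w with hα
  have hαb : |α| ≤ 1 / ((Q:ℝ) + 1) := by
    have h1 : (r:ℝ) = p / q := by
      rw [Rat.cast_def]
      simp [hp, hq]
    have h2 : α = -(w - r) * q := by rw [h1, hα]; field_simp; ring
    rw [h2, abs_mul, abs_neg, abs_of_pos hq0]
    have h3 : |w - r| ≤ 1 / (((Q:ℝ) + 1) * q) := by
      have : ((r.den:ℕ):ℝ) = (q:ℝ) := by simp [hq]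
      rw [← this]
      exact hr
    calc |w - r| * q ≤ 1 / (((Q:ℝ) + 1) * q) * q := by gcongr
      _ = _ := by field_simp
  have hαQ : |α| * Q ≤ 1 := by
    calc |α| * Q ≤ 1 / ((Q:ℝ) + 1) * ((Q:ℝ) + 1) := by gcongr; linarith
      _ = 1 := by field_simp
  have hα1 : |α| < 1 := by
    refine hαb.trans_lt ?_
    rw [div_lt_one (by positivity)]; linarith
  have hpw : (p:ℝ) = q * w + α := by rw [hα]; ring
  have hqw : 1 ≤ q * w := by nlinarith
  have hαl := abs_lt.1 hα1
  have hppos : (0:ℝ) < p := by rw [hpw]; linarith [hαl.1]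
  have hpu : (p:ℝ) ≤ 5 * q * (Q:ℝ)^2 := by
    have h1 : q * w ≤ q * (4 * (Q:ℝ)^2) := by gcongr
    have h2 : 1 ≤ q * (Q:ℝ)^2 := by nlinarith
    rw [hpw]; linarith [hαl.2]
  -- κ
  set κ : ℝ := y - w^3 with hκ
  have hκb : |κ| * (Q:ℝ)^2 ≤ C := by
    have e : (x:ℝ)^3 - (y:ℝ)^2 = -(κ * (y + w^3)) := by rw [hκ, ← hw2]; ring
    rw [e, abs_neg, abs_mul, abs_of_pos (by positivity : (0:ℝ) < y + w^3)] at h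
    have h1 : |κ| * w^3 ≤ C * w^2 := by
      calc |κ| * w^3 ≤ |κ| * (y + w^3) := by gcongr; linarith
        _ ≤ _ := by rw [hw2]; exact h
    have h2 : |κ| * w ≤ C := by
      have : (|κ| * w) * w^2 ≤ C * w^2 := by linarith
      exact le_of_mul_le_mul_right this (by positivity)
    calc |κ| * (Q:ℝ)^2 ≤ |κ| * w := by gcongr
      _ ≤ C := h2
  have hmv : (mmv q (p,x,y):ℝ) = 3 * α^2 * p - 2 * α^3 + 2 * κ * q^3 := by
    unfold mmv; push_cast
    rw [← hw2, hκ, hα]; ring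
  have hsv : (sgv q (p,x,y):ℝ) = -2 * α * p + α^2 := by
    unfold sgv; push_cast
    rw [← hw2, hα]; ring
  have ha0 := abs_nonneg α
  have hk0 := abs_nonneg κ
  have hα2 : |α|^2 * (Q:ℝ)^2 ≤ 1 := by
    rw [← mul_pow]; exact pow_le_one₀ (by positivity) hαQ
  have b1 : |α|^2 * p ≤ 5 * q := by
    calc |α|^2 * p ≤ |α|^2 * (5 * q * (Q:ℝ)^2) := by gcongr
      _ = (|α|^2 * (Q:ℝ)^2) * (5 * q) := by ring
      _ ≤ 1 * (5 * q) := by gcongr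
      _ = _ := by ring
  have b2 : |α|^3 ≤ 1 := pow_le_one₀ ha0 hα1.le
  have b2' : |α|^4 ≤ 1 := pow_le_one₀ ha0 hα1.le
  have b3 : |κ| * q^3 ≤ C * q := by
    calc |κ| * q^3 = |κ| * (q:ℝ)^2 * q := by ring
      _ ≤ |κ| * (Q:ℝ)^2 * q := by gcongr
      _ ≤ _ := by gcongr
  have b4 : |α|^3 * p ≤ 5 := by
    calc |α|^3 * p ≤ |α|^3 * (5 * q * (Q:ℝ)^2) := by gcongr
      _ = 5 * ((|α|^2 * (Q:ℝ)^2) * (|α| * q)) := by ring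
      _ ≤ 5 * (1 * (|α| * Q)) := by gcongr
      _ ≤ 5 := by linarith
  have b5 : |κ| * q^3 * p ≤ 5 * C * q^4 := by
    calc |κ| * q^3 * p ≤ |κ| * q^3 * (5 * q * (Q:ℝ)^2) := by gcongr
      _ = 5 * (|κ| * (Q:ℝ)^2) * q^4 := by ring
      _ ≤ 5 * C * q^4 := by gcongr
  have hq4 : (1:ℝ) ≤ (q:ℝ)^4 := one_le_pow₀ hqr
  refine ⟨q, p, hqpos, hqQ, hcop, by exact_mod_cast hppos, hpu, ?_, ?_⟩
  · rw [hmv]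
    have t1 : |3 * α^2 * p| = 3 * (|α|^2 * p) := by
      rw [abs_mul, abs_mul, abs_pow, abs_of_pos hppos]; norm_num; ring
    have t2 : |2 * α^3| = 2 * |α|^3 := by rw [abs_mul, abs_pow]; norm_num
    have t3 : |2 * κ * q^3| = 2 * (|κ| * q^3) := by
      rw [abs_mul, abs_mul, abs_pow, abs_of_pos hq0]; norm_num; ring
    have t4 := abs_add_le (3 * α^2 * p - 2 * α^3) (2 * κ * q^3)
    have t5 := abs_sub (3 * α^2 * p) (2 * α^3)
    rw [t3] at t4
    rw [t1, t2] at t5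
    have : 0 ≤ C * q := by positivity
    have e2 : (24 + 40 * C) * (q:ℝ) = 24 * q + 40 * (C * q) := by ring
    rw [e2]
    linarith
  · have e : 4 * (mmv q (p,x,y):ℝ) * p - 3 * (sgv q (p,x,y) : ℝ)^2
        = 4 * α^3 * p - 3 * α^4 + 8 * κ * q^3 * p := by
      rw [hmv, hsv]; ring
    rw [e]
    have t1 : |4 * α^3 * p| = 4 * (|α|^3 * p) := by
      rw [abs_mul, abs_mul, abs_pow, abs_of_pos hppos]; norm_num; ring
    have t2 : |3 * α^4| = 3 * |α|^4 := by rw [abs_mul, abs_pow]; norm_num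
    have t3 : |8 * κ * q^3 * p| = 8 * (|κ| * q^3 * p) := by
      rw [abs_mul, abs_mul, abs_mul, abs_pow, abs_of_pos hq0, abs_of_pos hppos]; norm_num; ring
    have t4 := abs_add_le (4 * α^3 * p - 3 * α^4) (8 * κ * q^3 * p)
    have t5 := abs_sub (4 * α^3 * p) (3 * α^4)
    rw [t3] at t4
    rw [t1, t2] at t5
    have e2 : (24 + 40 * C) * (q:ℝ)^4 = 24 * q^4 + 8 * (5 * C * q^4) := by ring
    rw [e2]
    linarith

lemma block (C : ℝ) (hC : 0 < C) : ∃ L : ℝ, 0 < L ∧ ∀ (Q : ℕ), 1 ≤ Q → ∀ S : Finset (ℤ × ℤ),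
    (∀ s ∈ S, 0 < s.1 ∧ 0 < s.2 ∧ (Q:ℝ)^4 ≤ s.1 ∧ (s.1:ℝ) ≤ 16 * (Q:ℝ)^4 ∧
      |(s.1:ℝ)^3 - (s.2:ℝ)^2| ≤ C * s.1) → (S.card : ℝ) ≤ L * ((Q:ℝ)^2 * (1 + Real.log Q)) := by
  set K := 24 + 40 * C with hK
  have hK1 : 1 ≤ K := by rw [hK]; linarith
  refine ⟨(1 + 2 * K) * (400 * K * (20 + K)), by positivity, ?_⟩
  intro Q hQ S hS
  have hex : ∀ s : ℤ × ℤ, ∃ qp : ℤ × ℤ, s ∈ S → (1 ≤ qp.1 ∧ qp.1 ≤ (Q:ℤ) ∧ IsCoprime qp.1 qp.2 ∧ 0 < qp.2 ∧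
      (qp.2:ℝ) ≤ 5 * qp.1 * (Q:ℝ)^2 ∧
      |(mmv qp.1 (qp.2,s):ℝ)| ≤ K * qp.1 ∧
      |4 * (mmv qp.1 (qp.2,s):ℝ) * qp.2 - 3 * (sgv qp.1 (qp.2,s) : ℝ)^2| ≤ K * qp.1^4) := by
    intro s
    by_cases hs : s ∈ S
    · obtain ⟨h1, h2, h3, h4, h5⟩ := hS s hs
      obtain ⟨q, p, h⟩ := approx_s19 C hC Q hQ s.1 s.2 h1 h2 h3 h4 h5
      exact ⟨(q, p), fun _ => h⟩
    · exact ⟨0, fun h => absurd h hs⟩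
  choose g hg using hex
  have hmaps : ∀ s ∈ S, (g s).1.toNat ∈ Finset.Icc 1 Q := by
    intro s hs
    have := hg s hs
    rw [Finset.mem_Icc]
    omega
  rw [Finset.card_eq_sum_card_fiberwise hmaps]
  push_cast
  have hb : ∀ n ∈ Finset.Icc 1 Q, ((S.filter (fun s => (g s).1.toNat = n)).card : ℝ) ≤
      (1 + 2 * K) * (400 * K * (20 + K)) * ((Q:ℝ)^2 * (n:ℝ)⁻¹) := by
    intro n hn
    rw [Finset.mem_Icc] at hn
    set F := S.filter (fun s => (g s).1.toNat = n) with hF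
    have hcard : (F.image (fun s => ((g s).2, s))).card = F.card := by
      apply Finset.card_image_of_injOn
      intro s _ t _ hst
      exact (Prod.mk.inj hst).2
    rw [← hcard]
    have hmem : ∀ t ∈ F.image (fun s => ((g s).2, s)), ∃ s ∈ S, (g s).1 = (n:ℤ) ∧ t = ((g s).2, s) := by
      intro t ht
      obtain ⟨s, hs, rfl⟩ := Finset.mem_image.1 ht
      have hs := Finset.mem_filter.1 hs
      refine ⟨s, hs.1, ?_, rfl⟩
      have := (hg s hs.1).1
      omega
    have := core2 K Q hK1 (n:ℤ) (by omega) (by exact_mod_cast hn.2) (F.image (fun s => ((g s).2, s)))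
      (by
        intro t ht
        obtain ⟨s, hs, h1, rfl⟩ := hmem t ht
        rw [← h1]
        exact (hg s hs).2.2.1)
      (by
        intro t ht
        obtain ⟨s, hs, h1, rfl⟩ := hmem t ht
        rw [← h1]
        exact ⟨(hg s hs).2.2.2.1, (hg s hs).2.2.2.2.1⟩)
      (by
        intro t ht
        obtain ⟨s, hs, h1, rfl⟩ := hmem t ht
        rw [← h1]
        exact (hg s hs).2.2.2.2.2.1)
      (by
        intro t ht
        obtain ⟨s, hs, h1, rfl⟩ := hmem t ht
        rw [← h1]
        exact (hg s hs).2.2.2.2.2.2)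
    simpa [div_eq_mul_inv] using this
  refine (Finset.sum_le_sum hb).trans ?_
  rw [← Finset.mul_sum, ← Finset.mul_sum]
  have hh := harmonic_le_one_add_log Q
  rw [harmonic_eq_sum_Icc] at hh
  push_cast at hh
  gcongr

/-- For each `C₁ > 0` there is a `C₂ > 0` such that for every `X ≥ 2` there are at most
`C₂ X^{1/2} log X` pairs of positive integers `(x, y)` with `x ≤ X` and `|x³ - y²| ≤ C₁ x`. -/
theorem count_integer_points_near_semicubical_parabola (C₁ : ℝ) (hC₁ : 0 < C₁) :
    ∃ C₂ : ℝ, 0 < C₂ ∧ ∀ X : ℝ, 2 ≤ X →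
      (Nat.card {p : ℤ × ℤ // 0 < p.1 ∧ 0 < p.2 ∧ (p.1 : ℝ) ≤ X ∧
          (|p.1 ^ 3 - p.2 ^ 2| : ℝ) ≤ C₁ * (p.1 : ℝ)} : ℝ) ≤
        C₂ * X ^ ((1 : ℝ) / 2) * Real.log X := by
  obtain ⟨L, hL, hblock⟩ := block C₁ hC₁
  refine ⟨6 * L, by positivity, ?_⟩
  intro X hX
  have hlog2 : 0.69 < Real.log 2 := lt_trans (by norm_num) Real.log_two_gt_d9
  have hlogX : Real.log 2 ≤ Real.log X := Real.log_le_log (by norm_num) hX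
  have hlog0 : 0 < Real.log X := by linarith
  have hX0 : 0 < X := by linarith
  set P : ℤ × ℤ → Prop := fun p => 0 < p.1 ∧ 0 < p.2 ∧ (p.1 : ℝ) ≤ X ∧
          (|p.1 ^ 3 - p.2 ^ 2| : ℝ) ≤ C₁ * (p.1 : ℝ) with hP
  change (Nat.card {p // P p} : ℝ) ≤ _
  by_cases hfin : Set.Finite {p | P p}
  swap
  · have : Infinite {p // P p} := Set.infinite_coe_iff.2 hfin
    rw [Nat.card_eq_zero_of_infinite]
    simp only [Nat.cast_zero]
    positivity
  have hcard : Nat.card {p // P p} = hfin.toFinset.card := by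
    exact Nat.card_eq_card_finite_toFinset hfin
  rw [hcard]
  set S := hfin.toFinset with hS
  have hSP : ∀ s ∈ S, P s := fun s hs => by simpa [hS] using hs
  set J := Nat.log 16 ⌊X⌋₊ with hJ
  have hmaps : ∀ s ∈ S, Nat.log 16 s.1.toNat ∈ Finset.range (J+1) := by
    intro s hs
    obtain ⟨h1, h2, h3, h4⟩ := hSP s hs
    rw [Finset.mem_range, Nat.lt_succ_iff]
    apply Nat.log_mono_right
    apply Nat.le_floor
    have : ((s.1.toNat : ℤ) : ℝ) = s.1 := by rw [Int.toNat_of_nonneg h1.le]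
    have h5 : ((s.1.toNat : ℕ) : ℝ) = s.1 := by exact_mod_cast this
    rw [h5]; exact h3
  have h16 : (16:ℝ)^J ≤ X := by
    have h1 : 16^J ≤ ⌊X⌋₊ := Nat.pow_log_le_self 16 (by
      have : 1 ≤ ⌊X⌋₊ := Nat.le_floor (by push_cast; linarith)
      omega)
    have h2 : ((16^J : ℕ):ℝ) ≤ ⌊X⌋₊ := by exact_mod_cast h1
    push_cast at h2
    exact h2.trans (Nat.floor_le hX0.le)
  have h4 : (4:ℝ)^J ≤ X ^ ((1:ℝ)/2) := by
    rw [← Real.sqrt_eq_rpow]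
    apply Real.le_sqrt_of_sq_le
    rw [← pow_mul, mul_comm, pow_mul]
    norm_num
    exact h16
  have hJlog : (J:ℝ) * Real.log 2 ≤ Real.log X := by
    have h1 : (2:ℝ)^J ≤ X := le_trans (by gcongr; norm_num) h16
    have := Real.log_le_log (by positivity) h1
    rwa [Real.log_pow] at this
  rw [Finset.card_eq_sum_card_fiberwise hmaps]
  push_cast
  have hb : ∀ j ∈ Finset.range (J+1), ((S.filter (fun s => Nat.log 16 s.1.toNat = j)).card : ℝ) ≤
      (4:ℝ)^j * (L * (3 * Real.log X)) := by
    intro j hj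
    rw [Finset.mem_range, Nat.lt_succ_iff] at hj
    have hQ4 : (((2^j : ℕ) : ℝ))^4 = (16:ℝ)^j := by
      push_cast
      rw [← pow_mul, mul_comm, pow_mul]; norm_num
    have hQ2 : (((2^j : ℕ) : ℝ))^2 = (4:ℝ)^j := by
      push_cast
      rw [← pow_mul, mul_comm, pow_mul]; norm_num
    have := hblock (2^j) Nat.one_le_two_pow (S.filter (fun s => Nat.log 16 s.1.toNat = j)) (by
      intro s hs
      obtain ⟨hs, hsj⟩ := Finset.mem_filter.1 hs
      obtain ⟨h1, h2, h3, h4⟩ := hSP s hs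
      have : ((s.1.toNat : ℤ) : ℝ) = s.1 := by rw [Int.toNat_of_nonneg h1.le]
      have h5 : ((s.1.toNat : ℕ) : ℝ) = s.1 := by exact_mod_cast this
      refine ⟨h1, h2, ?_, ?_, h4⟩
      · rw [hQ4, ← h5, ← hsj]
        have := Nat.pow_log_le_self 16 (x := s.1.toNat) (by omega)
        exact_mod_cast this
      · rw [hQ4, ← h5, ← hsj]
        have := (Nat.lt_pow_succ_log_self (b := 16) (by norm_num) s.1.toNat).le
        rw [pow_succ, mul_comm] at this
        exact_mod_cast this)
    rw [hQ2] at this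
    refine this.trans ?_
    have hl : Real.log ((2^j : ℕ) : ℝ) ≤ Real.log X := by
      push_cast
      rw [Real.log_pow]
      refine le_trans ?_ hJlog
      gcongr
    calc L * ((4:ℝ)^j * (1 + Real.log ((2^j : ℕ) : ℝ))) ≤ L * ((4:ℝ)^j * (3 * Real.log X)) := by
          gcongr; linarith
      _ = _ := by ring
  refine (Finset.sum_le_sum hb).trans ?_
  rw [← Finset.sum_mul]
  have hg : ∀ n : ℕ, ∑ j ∈ Finset.range (n+1), (4:ℝ)^j ≤ 2 * 4^n := by
    intro n
    induction n with
    | zero => simp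
    | succ n ih =>
      rw [Finset.sum_range_succ, pow_succ]
      have : (0:ℝ) < 4^n := by positivity
      linarith
  calc _ ≤ (2 * X ^ ((1:ℝ)/2)) * (L * (3 * Real.log X)) := by
        gcongr
        exact (hg J).trans (by linarith)
    _ = _ := by ring
end
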